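/- Normal form near an elliptic magnetic axis (Theorem 1, elliptic case): Let (B,J,p) be an integrable magnetic field on an open set U ⊆ ℝ³ and let γ ⊆ U be a nondegenerate elliptic magnetic axis. Then there exist r > 0, δ > 0, a C^∞ map Φ : D_r × ℝ → U where D_r = {(x,y) ∈ ℝ² : x² + y² < r²}, C^∞ functions P, Ψ : (−δ, r²/2) → ℝ, and a constant c ∈ {1, −1}, such that: (i) Φ(x,y,φ+2π) = Φ(x,y,φ) for all (x,y,φ); (ii) Φ has everywhere invertible differential, its image is an open neighborhood of γ, Φ({(0,0)} × ℝ) = γ, and Φ(x,y,φ) = Φ(x',y',φ') holds iff (x,y) = (x',y') and φ − φ' ∈ 2πℤ; (iii) for all (x,y,φ) ∈ D_r × ℝ, writing ψ = (x² + y²)/2, one has p(Φ(x,y,φ)) = P(ψ) and det(DΦ(x,y,φ)) · (DΦ(x,y,φ))⁻¹ (B(Φ(x,y,φ))) = (−Ψ′(ψ)·y, Ψ′(ψ)·x, c). -/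

import Mathlib

noncomputable section

open RealInnerProductSpace

/-- `ℝ³` as a Euclidean space. -/
abbrev R3 : Type := EuclideanSpace ℝ (Fin 3)

/-- The point `(x, y, z)` of `ℝ³`. -/
def pt (x y z : ℝ) : R3 := !₂[x, y, z]

/-- Divergence of a vector field: the trace of its derivative. -/
def divg (v : R3 → R3) (z : R3) : ℝ :=
  LinearMap.trace ℝ R3 (fderiv ℝ v z).toLinearMap

/-- Cross product on `ℝ³`. -/
def cross3 (u v : R3) : R3 :=
  pt (u 1 * v 2 - u 2 * v 1) (u 2 * v 0 - u 0 * v 2) (u 0 * v 1 - u 1 * v 0)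

/-- Standard basis vectors of `ℝ³`. -/
def e3 (i : Fin 3) : R3 := EuclideanSpace.single i 1

/-- Curl of a vector field on `ℝ³`. -/
def curl (v : R3 → R3) (z : R3) : R3 :=
  pt (fderiv ℝ v z (e3 1) 2 - fderiv ℝ v z (e3 2) 1)
     (fderiv ℝ v z (e3 2) 0 - fderiv ℝ v z (e3 0) 2)
     (fderiv ℝ v z (e3 0) 1 - fderiv ℝ v z (e3 1) 0)

/-- The Hessian of `p` at `z`, as a bilinear form. -/
def hess (p : R3 → ℝ) (z : R3) (u v : R3) : ℝ :=
  (iteratedFDeriv ℝ 2 p z) ![u, v]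

/-- `γ` is the image of a periodic integral curve of `B` lying in `U`. -/
def IsPeriodicOrbit (U : Set R3) (B : R3 → R3) (γ : Set R3) : Prop :=
  ∃ (c : ℝ → R3) (T : ℝ), 0 < T ∧ (∀ t, c t ∈ U) ∧
    (∀ t, c (t + T) = c t) ∧ (∀ t, HasDerivAt c (B (c t)) t) ∧ Set.range c = γ

/-- An integrable magnetic field `(B, J, p)` on an open set `U ⊆ ℝ³`. -/
structure IntegrableMagneticField (U : Set R3) (B J : R3 → R3) (p : R3 → ℝ) : Prop where
  isOpen_U : IsOpen U
  smooth_B : ContDiffOn ℝ (⊤ : ℕ∞) B U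
  smooth_J : ContDiffOn ℝ (⊤ : ℕ∞) J U
  smooth_p : ContDiffOn ℝ (⊤ : ℕ∞) p U
  B_ne_zero : ∀ z ∈ U, B z ≠ 0
  div_B : ∀ z ∈ U, divg B z = 0
  div_J : ∀ z ∈ U, divg J z = 0
  hamiltonian : ∀ z ∈ U, cross3 (J z) (B z) = gradient p z

/-- A nondegenerate elliptic magnetic axis: a compact image of a periodic integral
curve of `B` on which `∇p = 0` and the Hessian of `p`, restricted to the plane
orthogonal to `B`, is positive or negative definite. -/
def IsNondegenerateEllipticAxis (U : Set R3) (B : R3 → R3) (p : R3 → ℝ)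
    (γ : Set R3) : Prop :=
  IsCompact γ ∧ γ ⊆ U ∧ IsPeriodicOrbit U B γ ∧
  (∀ z ∈ γ, gradient p z = 0) ∧
  ∀ z ∈ γ,
    (∀ u : R3, u ≠ 0 → ⟪u, B z⟫ = 0 → 0 < hess p z u u) ∨
    (∀ u : R3, u ≠ 0 → ⟪u, B z⟫ = 0 → hess p z u u < 0)

/-- The solid cylinder `D_r × ℝ = {(x,y,φ) : x² + y² < r²}` in `ℝ³`. -/
def Dset (r : ℝ) : Set R3 := {q | (q 0) ^ 2 + (q 1) ^ 2 < r ^ 2}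

noncomputable section NemytskiiOperator
open Set Filter Topology ContinuousMap
open scoped ContDiff

universe u v

variable {K : Type v} {E F : Type u} [TopologicalSpace K] [CompactSpace K]
  [NormedAddCommGroup E] [NormedSpace ℝ E] [NormedAddCommGroup F] [NormedSpace ℝ F]

/-- Pointwise application of a continuous family of operators, as a bilinear map. -/
def pointwiseApplyₗ (K : Type v) (E F : Type u) [TopologicalSpace K] [CompactSpace K]
    [NormedAddCommGroup E] [NormedSpace ℝ E] [NormedAddCommGroup F] [NormedSpace ℝ F] :
    C(K, E →L[ℝ] F) →ₗ[ℝ] C(K, E) →ₗ[ℝ] C(K, F) where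
  toFun A :=
    { toFun := fun u => ⟨fun k => A k (u k), A.continuous.clm_apply u.continuous⟩
      map_add' := fun u v => by ext k; simp
      map_smul' := fun c u => by ext k; simp }
  map_add' A B := by ext u k; simp
  map_smul' c A := by ext u k; simp

theorem norm_pointwiseApplyₗ_le (A : C(K, E →L[ℝ] F)) (u : C(K, E)) :
    ‖pointwiseApplyₗ K E F A u‖ ≤ 1 * ‖A‖ * ‖u‖ := by
  rw [ContinuousMap.norm_le _ (by positivity)]
  intro k
  calc ‖A k (u k)‖ ≤ ‖A k‖ * ‖u k‖ := (A k).le_opNorm _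
    _ ≤ ‖A‖ * ‖u‖ := by gcongr <;> exact ContinuousMap.norm_coe_le_norm _ k
    _ = 1 * ‖A‖ * ‖u‖ := by ring

/-- Pointwise application of a continuous family of operators to a continuous function. -/
def pointwiseApply (K : Type v) (E F : Type u) [TopologicalSpace K] [CompactSpace K]
    [NormedAddCommGroup E] [NormedSpace ℝ E] [NormedAddCommGroup F] [NormedSpace ℝ F] :
    C(K, E →L[ℝ] F) →L[ℝ] C(K, E) →L[ℝ] C(K, F) :=
  LinearMap.mkContinuous₂ (E := C(K, E →L[ℝ] F)) (F := C(K, E)) (G := C(K, F))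
    (σ₂₃ := RingHom.id ℝ) (σ₁₃ := RingHom.id ℝ) (pointwiseApplyₗ K E F) 1
    norm_pointwiseApplyₗ_le

@[simp] theorem pointwiseApply_apply (A : C(K, E →L[ℝ] F)) (u : C(K, E)) (k : K) :
    pointwiseApply K E F A u k = A k (u k) := rfl

theorem hasFDerivAt_comp_continuousMap {f : E → F} (hf : ContDiff ℝ 1 f) (u : C(K, E)) :
    HasFDerivAt (fun u : C(K, E) => (⟨f, hf.continuous⟩ : C(E, F)).comp u)
      (pointwiseApply K E F
        ((⟨fderiv ℝ f, hf.continuous_fderiv one_ne_zero⟩ : C(E, E →L[ℝ] F)).comp u)) u := by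
  rw [hasFDerivAt_iff_isLittleO, Asymptotics.isLittleO_iff]
  intro c hc
  have hcomp : IsCompact (range u) := isCompact_range u.continuous
  have hunif := hcomp.uniformContinuousAt_of_continuousAt (fderiv ℝ f)
    (fun a _ => (hf.continuous_fderiv one_ne_zero).continuousAt) (Metric.dist_mem_uniformity hc)
  obtain ⟨δ, hδ, hδ'⟩ := Metric.mem_uniformity_dist.1 hunif
  filter_upwards [Metric.ball_mem_nhds u hδ] with v hv
  rw [ContinuousMap.norm_le _ (by positivity)]
  intro k
  have hk : ‖v k - u k‖ ≤ ‖v - u‖ := ContinuousMap.norm_coe_le_norm (v - u) k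
  have hseg : ∀ y ∈ segment ℝ (u k) (v k), ‖fderiv ℝ f y - fderiv ℝ f (u k)‖ ≤ c := by
    intro y hy
    have h1 : dist (u k) y < δ := by
      rw [dist_comm]
      calc dist y (u k) = ‖y - u k‖ := dist_eq_norm _ _
        _ ≤ ‖v k - u k‖ := norm_sub_le_of_mem_segment hy
        _ ≤ ‖v - u‖ := hk
        _ < δ := by rwa [← dist_eq_norm]
    have := hδ' h1 (mem_range_self k)
    rw [← dist_eq_norm, dist_comm]
    exact le_of_lt this
  have := (convex_segment (u k) (v k)).norm_image_sub_le_of_norm_hasFDerivWithin_le'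
    (f := f) (f' := fderiv ℝ f) (φ := fderiv ℝ f (u k)) (C := c)
    (fun y _ => (hf.differentiable one_ne_zero y).hasFDerivAt.hasFDerivWithinAt) hseg
    (left_mem_segment ℝ _ _) (right_mem_segment ℝ _ _)
  refine le_trans ?_ (this.trans (by gcongr))
  simp

theorem contDiff_comp_continuousMap_nat (n : ℕ) : ∀ {F : Type u} [NormedAddCommGroup F]
    [NormedSpace ℝ F] {f : E → F} (hf : ContDiff ℝ ∞ f),
    ContDiff ℝ n (fun u : C(K, E) => (⟨f, hf.continuous⟩ : C(E, F)).comp u) := by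
  induction n with
  | zero =>
    intro F _ _ f hf
    exact contDiff_zero.2 (ContinuousMap.continuous_postcomp _)
  | succ n ih =>
    intro F _ _ f hf
    have h' : ContDiff ℝ ∞ (fderiv ℝ f) := hf.fderiv_right (by simp)
    refine contDiff_succ_iff_hasFDerivAt.2 ⟨_, ?_, hasFDerivAt_comp_continuousMap
      (hf.of_le (by exact_mod_cast le_top))⟩
    exact (pointwiseApply K E F).contDiff.comp (ih h')

theorem contDiff_comp_continuousMap {f : E → F} (hf : ContDiff ℝ ∞ f) :
    ContDiff ℝ ∞ (fun u : C(K, E) => (⟨f, hf.continuous⟩ : C(E, F)).comp u) :=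
  contDiff_infty.2 fun n => contDiff_comp_continuousMap_nat n hf

/-- Integration over a subinterval of `[0, 1]` as a continuous linear functional. -/
def intervalIntegralCLM (F : Type*) [NormedAddCommGroup F] [NormedSpace ℝ F]
    (a b : ℝ) (hab : a ≤ b) : C(Icc a b, F) →L[ℝ] F :=
  LinearMap.mkContinuous
    { toFun := fun u => ∫ t in a..b, u (projIcc a b hab t)
      map_add' := fun u v => by
        simp only [ContinuousMap.add_apply]
        exact intervalIntegral.integral_add
          ((u.continuous.comp continuous_projIcc).intervalIntegrable _ _)
          ((v.continuous.comp continuous_projIcc).intervalIntegrable _ _)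
      map_smul' := fun c u => by simp }
    |b - a| (fun u => by
      rw [mul_comm]
      exact intervalIntegral.norm_integral_le_of_norm_le_const
        fun t _ => ContinuousMap.norm_coe_le_norm u _)

/-- Integrals over a compact interval depend smoothly on parameters. -/
theorem contDiff_intervalIntegral_of_contDiff {f : E × ℝ → F} (hf : ContDiff ℝ ∞ f)
    {a b : ℝ} (hab : a ≤ b) : ContDiff ℝ ∞ (fun x => ∫ t in a..b, f (x, t)) := by
  let ι : E → C(Icc a b, E × ℝ) := fun x => ⟨fun t => (x, (t : ℝ)), by fun_prop⟩
  have hι : ContDiff ℝ ∞ ι := by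
    let A : E →L[ℝ] C(Icc a b, E × ℝ) := LinearMap.mkContinuous
      { toFun := fun x => ⟨fun _ => (x, 0), by fun_prop⟩
        map_add' := fun x y => by ext t <;> simp
        map_smul' := fun c x => by ext t <;> simp } 1 (fun x => by
          rw [ContinuousMap.norm_le _ (by positivity)]
          intro t
          simp [Prod.norm_def])
    have : ι = fun x => A x + ι 0 := by
      ext x t <;> simp [ι, A]
    rw [this]
    exact A.contDiff.add contDiff_const
  have h := (intervalIntegralCLM F a b hab).contDiff.comp ((contDiff_comp_continuousMap hf).comp hι)
  convert! h using 1
  ext x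
  refine intervalIntegral.integral_congr fun t ht => ?_
  rw [uIcc_of_le hab] at ht
  simp [ι, projIcc_of_mem hab ht]

end NemytskiiOperator

noncomputable section SmoothFlow
open Set Filter Topology ContinuousMap
open scoped ContDiff NNReal

variable {E : Type} [NormedAddCommGroup E] [NormedSpace ℝ E]

/-- A bounded Lipschitz vector field has global integral curves. -/
theorem exists_global_integralCurve [CompleteSpace E] {X : E → E} {M K : ℝ≥0} (hM : ∀ x, ‖X x‖ ≤ M)
    (hK : LipschitzWith K X) (x : E) :
    ∃ c : ℝ → E, c 0 = x ∧ ∀ t, HasDerivAt c (X (c t)) t := by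
  have hloc : ∀ n : ℕ, ∃ α : ℝ → E, α 0 = x ∧
      ∀ t ∈ Ioo (-(n + 1 : ℝ)) (n + 1), HasDerivAt α (X (α t)) t := by
    intro n
    have h0 : (0 : ℝ) ∈ Icc (-(n + 1 : ℝ)) (n + 1) := by
      constructor <;> linarith [n.cast_nonneg (α := ℝ)]
    have hpl : IsPicardLindelof (fun _ => X) (⟨0, h0⟩ : Icc (-(n + 1 : ℝ)) (n + 1)) x
        (M * (n + 1)) 0 M K :=
      { lipschitzOnWith := fun t _ => hK.lipschitzOnWith
        continuousOn := fun _ _ => continuousOn_const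
        norm_le := fun _ _ y _ => hM y
        mul_max_le := by simp }
    obtain ⟨α, h1, h2⟩ := hpl.exists_eq_forall_mem_Icc_hasDerivWithinAt₀
    exact ⟨α, h1, fun t ht => (h2 t (Ioo_subset_Icc_self ht)).hasDerivAt (Icc_mem_nhds ht.1 ht.2)⟩
  choose α h0 hα using hloc
  have hagree : ∀ m n : ℕ, m ≤ n → EqOn (α m) (α n) (Ioo (-(m + 1 : ℝ)) (m + 1)) := by
    intro m n hmn
    have hmn' : (m : ℝ) ≤ n := by exact_mod_cast hmn
    refine ODE_solution_unique_of_mem_Ioo (v := fun _ => X) (s := fun _ => univ) (K := K) (t₀ := 0)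
      (fun t _ => hK.lipschitzOnWith) (by constructor <;> linarith [m.cast_nonneg (α := ℝ)])
      (fun t ht => ⟨hα m t ht, mem_univ _⟩)
      (fun t ht => ⟨hα n t ⟨by linarith [ht.1], by linarith [ht.2]⟩, mem_univ _⟩) (by rw [h0, h0])
  refine ⟨fun t => α ⌈|t|⌉₊ t, by simp [h0], fun t => ?_⟩
  set N := ⌈|t|⌉₊ + 1 with hN
  have hlt : |t| < N := by
    have := Nat.le_ceil |t|
    push_cast [hN]
    linarith
  have hev : ∀ s : ℝ, |s| ≤ N → α ⌈|s|⌉₊ s = α N s := by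
    intro s hs
    have h1 : |s| < ⌈|s|⌉₊ + 1 := lt_of_le_of_lt (Nat.le_ceil _) (by linarith)
    exact hagree _ _ (Nat.ceil_le.2 hs) ⟨by linarith [neg_abs_le s], by linarith [le_abs_self s]⟩
  have hd : HasDerivAt (α N) (X (α N t)) t :=
    hα N t ⟨by linarith [neg_abs_le t], by linarith [le_abs_self t]⟩
  simp only [hev t hlt.le]
  refine hd.congr_of_eventuallyEq ?_
  filter_upwards [continuous_abs.continuousAt.eventually_lt continuousAt_const hlt] with s hs
  exact hev s hs.le

/-- Primitives of continuous functions on `[0, 1]`, as an operator. -/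
def volterraₗ (E : Type) [NormedAddCommGroup E] [NormedSpace ℝ E] :
    C(Icc (0 : ℝ) 1, E) →ₗ[ℝ] C(Icc (0 : ℝ) 1, E) where
  toFun u := ⟨fun t => ∫ τ in (0 : ℝ)..t, u (projIcc 0 1 zero_le_one τ), by
    have : Continuous fun t : ℝ => ∫ τ in (0 : ℝ)..t, u (projIcc 0 1 zero_le_one τ) :=
      intervalIntegral.continuous_primitive (fun a b =>
        (u.continuous.comp continuous_projIcc).intervalIntegrable a b) 0
    exact this.comp continuous_subtype_val⟩
  map_add' u v := by
    ext t
    exact intervalIntegral.integral_add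
      ((u.continuous.comp continuous_projIcc).intervalIntegrable _ _)
      ((v.continuous.comp continuous_projIcc).intervalIntegrable _ _)
  map_smul' c u := by ext t; simp

theorem norm_volterraₗ_le (u : C(Icc (0 : ℝ) 1, E)) : ‖volterraₗ E u‖ ≤ 1 * ‖u‖ := by
  rw [ContinuousMap.norm_le _ (by positivity)]
  intro t
  have := intervalIntegral.norm_integral_le_of_norm_le_const (a := 0) (b := t) (C := ‖u‖)
    (f := fun τ => u (projIcc 0 1 zero_le_one τ))
    (fun τ _ => ContinuousMap.norm_coe_le_norm u _)
  refine this.trans ?_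
  rw [sub_zero, abs_of_nonneg t.2.1, mul_comm]
  gcongr
  exact t.2.2

/-- Primitives of continuous functions on `[0, 1]`, as a bounded operator. -/
def volterra (E : Type) [NormedAddCommGroup E] [NormedSpace ℝ E] :
    C(Icc (0 : ℝ) 1, E) →L[ℝ] C(Icc (0 : ℝ) 1, E) :=
  LinearMap.mkContinuous (volterraₗ E) 1 norm_volterraₗ_le

theorem norm_volterra_le : ‖volterra E‖ ≤ 1 :=
  LinearMap.mkContinuous_norm_le _ zero_le_one _

/-- Constant functions, as a bounded operator. -/
def constCLM (E : Type) [NormedAddCommGroup E] [NormedSpace ℝ E] :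
    E →L[ℝ] C(Icc (0 : ℝ) 1, E) :=
  LinearMap.mkContinuous
    ({ toFun := fun x => ContinuousMap.const _ x
       map_add' := fun x y => by ext t; simp
       map_smul' := fun c x => by ext t; simp } : E →ₗ[ℝ] C(Icc (0 : ℝ) 1, E)) 1 (fun x => by
          rw [ContinuousMap.norm_le _ (by positivity)]
          intro t
          simp)

/-- Solutions of a parametrised fixed-point equation with a contracting right-hand side are
smooth. -/
theorem contDiffAt_of_fixedPoint {V : Type} [NormedAddCommGroup V] [NormedSpace ℝ V]
    [CompleteSpace V] [CompleteSpace E] {N : V → V} {K : ℝ≥0} (hN : ContDiff ℝ ∞ N)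
    (hK : LipschitzWith K N) {W : V →L[ℝ] V} (hW : ‖W‖ ≤ 1) {ι : E →L[ℝ] V} {U : ℝ × E → V}
    (hU : ∀ s x, U (s, x) = ι x + s • W (N (U (s, x))))
    {s : ℝ} (hs : |s| * K < 1) (x : E) : ContDiffAt ℝ ∞ U (s, x) := by
  have huniq : ∀ (s : ℝ) (x : E) (u v), |s| * K < 1 → u = ι x + s • W (N u) →
      v = ι x + s • W (N v) → u = v := by
    intro s x u v hs hu hv
    have h1 : u - v = s • W (N u - N v) := by
      rw [map_sub, smul_sub]
      nth_rw 1 [hu, hv]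
      abel
    have h2 : ‖u - v‖ ≤ |s| * K * ‖u - v‖ := by
      calc ‖u - v‖ = ‖s • W (N u - N v)‖ := by rw [← h1]
        _ = |s| * ‖W (N u - N v)‖ := by rw [norm_smul, Real.norm_eq_abs]
        _ ≤ |s| * (1 * ‖N u - N v‖) := by
          gcongr
          exact W.le_of_opNorm_le hW _
        _ ≤ |s| * (1 * (K * ‖u - v‖)) := by gcongr; exact hK.norm_sub_le _ _
        _ = |s| * K * ‖u - v‖ := by ring
    by_contra hne
    have : 0 < ‖u - v‖ := norm_pos_iff.2 (sub_ne_zero.2 hne)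
    nlinarith
  let G : (ℝ × E) × V → V := fun q => q.2 - (ι q.1.2 + q.1.1 • W (N q.2))
  have hG : ContDiff ℝ ∞ G := by
    refine contDiff_snd.sub ((ι.contDiff.comp (contDiff_snd.comp contDiff_fst)).add
      ((contDiff_fst.comp contDiff_fst).smul (W.contDiff.comp (hN.comp contDiff_snd))))
  let q₀ : (ℝ × E) × V := ((s, x), U (s, x))
  have hG0 : ∀ s x, G ((s, x), U (s, x)) = 0 := fun s x => sub_eq_zero.2 (hU s x)
  let T : V →L[ℝ] V := s • (W ∘L fderiv ℝ N (U (s, x)))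
  have hT : ‖T‖ < 1 := by
    refine lt_of_le_of_lt ?_ hs
    rw [norm_smul, Real.norm_eq_abs]
    gcongr
    refine (ContinuousLinearMap.opNorm_comp_le _ _).trans ?_
    calc _ ≤ 1 * (K : ℝ) :=
          mul_le_mul hW (norm_fderiv_le_of_lipschitz ℝ hK) (norm_nonneg _) zero_le_one
      _ = K := one_mul _
  have hpart : fderiv ℝ G q₀ ∘L .inr ℝ (ℝ × E) V = 1 - T := by
    have h1 : HasFDerivAt (fun u => G ((s, x), u))
        (fderiv ℝ G q₀ ∘L .inr ℝ (ℝ × E) V) (U (s, x)) := by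
      refine HasFDerivAt.comp (U (s, x)) (g := G) ?_ (hasFDerivAt_prodMk_right (s, x) (U (s, x)))
      exact (hG.differentiable (by simp) _).hasFDerivAt
    have h3 : HasFDerivAt (fun u => W (N u)) (W ∘L fderiv ℝ N (U (s, x))) (U (s, x)) :=
      W.hasFDerivAt.comp _ (hN.differentiable (by simp) _).hasFDerivAt
    have h4 : HasFDerivAt (fun u => s • W (N u)) T (U (s, x)) := h3.const_smul s
    have h2 : HasFDerivAt (fun u => G ((s, x), u)) (1 - T) (U (s, x)) :=
      (hasFDerivAt_id (U (s, x))).sub (h4.const_add (ι x))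
    exact h1.unique h2
  have hinv : (fderiv ℝ G q₀ ∘L .inr ℝ (ℝ × E) V).IsInvertible := by
    rw [hpart]
    obtain ⟨w, hw⟩ := isUnit_one_sub_of_norm_lt_one hT
    exact ⟨ContinuousLinearEquiv.unitsEquiv ℝ _ w, by rw [← hw]; rfl⟩
  have hGat : ContDiffAt ℝ ∞ G q₀ := hG.contDiffAt
  have hψ := hGat.contDiffAt_implicitFunction (by simp) hinv
  have hev := hGat.eventually_apply_implicitFunction (by simp) hinv
  refine hψ.congr_of_eventuallyEq ?_
  have hsm : ∀ᶠ q : ℝ × E in 𝓝 (s, x), |q.1| * K < 1 := by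
    have : Continuous fun q : ℝ × E => |q.1| * (K : ℝ) := by fun_prop
    exact this.continuousAt.eventually_lt continuousAt_const hs
  have hq0 : G q₀ = 0 := hG0 s x
  filter_upwards [hev, hsm] with q hq hqs
  rw [hq0] at hq
  exact huniq q.1 q.2 _ _ hqs (hU q.1 q.2) (sub_eq_zero.1 hq)

/-- A map solving the integral equation of a smooth Lipschitz vector field is smooth
for small times. -/
theorem contDiffAt_flow_small [CompleteSpace E] {X : E → E} {K : ℝ≥0} (hX : ContDiff ℝ ∞ X)
    (hK : LipschitzWith K X) {U : ℝ × E → C(Icc (0 : ℝ) 1, E)}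
    (hU : ∀ s x, U (s, x) = constCLM E x +
      s • volterra E ((⟨X, hX.continuous⟩ : C(E, E)).comp (U (s, x))))
    {s : ℝ} (hs : |s| * K < 1) (x : E) : ContDiffAt ℝ ∞ U (s, x) := by
  refine contDiffAt_of_fixedPoint (contDiff_comp_continuousMap hX) (K := K)
    (LipschitzWith.of_dist_le_mul fun u v => ?_) norm_volterra_le hU hs x
  rw [ContinuousMap.dist_le (by positivity)]
  intro t
  exact (hK.dist_le_mul _ _).trans (by gcongr; exact ContinuousMap.dist_apply_le_dist t)

/-- A bounded smooth Lipschitz vector field has a smooth global flow. -/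
theorem exists_contDiff_flow [CompleteSpace E] {X : E → E} {M K : ℝ≥0}
    (hX : ContDiff ℝ ∞ X) (hM : ∀ x, ‖X x‖ ≤ M)
    (hK : LipschitzWith K X) :
    ∃ F : ℝ × E → E, ContDiff ℝ ∞ F ∧ (∀ x, F (0, x) = x) ∧
      (∀ t x, HasDerivAt (fun t => F (t, x)) (X (F (t, x))) t) ∧
      (∀ s t x, F (s + t, x) = F (s, F (t, x))) ∧
      (∀ c : ℝ → E, (∀ t, HasDerivAt c (X (c t)) t) → ∀ t, c t = F (t, c 0)) := by
  choose c hc0 hc using exists_global_integralCurve hM hK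
  have huniq : ∀ c₁ c₂ : ℝ → E, (∀ t, HasDerivAt c₁ (X (c₁ t)) t) →
      (∀ t, HasDerivAt c₂ (X (c₂ t)) t) → c₁ 0 = c₂ 0 → c₁ = c₂ := fun c₁ c₂ h₁ h₂ h =>
    ODE_solution_unique_univ (v := fun _ => X) (s := fun _ => univ) (K := K) (t₀ := 0)
      (fun t => hK.lipschitzOnWith) (fun t => ⟨h₁ t, mem_univ _⟩) (fun t => ⟨h₂ t, mem_univ _⟩) h
  let F : ℝ × E → E := fun q => c q.2 q.1
  have hgroup : ∀ s t x, F (s + t, x) = F (s, F (t, x)) := by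
    intro s t x
    exact congrFun (huniq (fun s => c x (s + t)) (c (c x t))
      (fun s => (hc x (s + t)).comp_add_const s t)
      (hc _) (by simp [hc0])) s
  have hcc : ∀ x, Continuous (c x) := fun x =>
    continuous_iff_continuousAt.2 fun t => (hc x t).continuousAt
  let U : ℝ × E → C(Icc (0 : ℝ) 1, E) := fun q =>
    ⟨fun t => c q.2 (q.1 * t), (hcc q.2).comp (by fun_prop)⟩
  have hU : ∀ s x, U (s, x) = constCLM E x +
      s • volterra E ((⟨X, hX.continuous⟩ : C(E, E)).comp (U (s, x))) := by
    intro s x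
    ext t
    have hd : ∀ τ : ℝ, HasDerivAt (fun τ => c x (s * τ)) (s • X (c x (s * τ))) τ := by
      intro τ
      exact HasDerivAt.scomp τ (hc x (s * τ)) (by simpa using (hasDerivAt_id τ).const_mul s)
    have hint := intervalIntegral.integral_eq_sub_of_hasDerivAt (a := 0) (b := (t : ℝ))
      (fun τ _ => hd τ) (Continuous.intervalIntegrable (by
        exact continuous_const.smul (hX.continuous.comp ((hcc x).comp (by fun_prop)))) _ _)
    have hcongr : ∫ τ in (0 : ℝ)..t, X (c x (s * (projIcc (0 : ℝ) 1 zero_le_one τ : ℝ))) =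
        ∫ τ in (0 : ℝ)..t, X (c x (s * τ)) := by
      refine intervalIntegral.integral_congr fun τ hτ => ?_
      rw [uIcc_of_le t.2.1] at hτ
      have := projIcc_of_mem (zero_le_one (α := ℝ)) ⟨hτ.1, hτ.2.trans t.2.2⟩
      simp [this]
    change c x (s * t) = x + s • ∫ τ in (0 : ℝ)..t,
      X (c x (s * (projIcc (0 : ℝ) 1 zero_le_one τ : ℝ)))
    rw [hcongr, ← intervalIntegral.integral_smul, hint]
    simp [hc0]
  have hsmall : ∀ (s : ℝ) x, |s| * K < 1 → ContDiffAt ℝ ∞ F (s, x) := by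
    intro s x hs
    have h1 := contDiffAt_flow_small hX hK hU hs x
    have h2 : F = fun q => ContinuousMap.evalCLM ℝ (1 : Icc (0 : ℝ) 1) (U q) := by
      ext q
      simp [F, U]
    rw [h2]
    exact (ContinuousLinearMap.contDiff _).contDiffAt.comp _ h1
  have hslice : ∀ s : ℝ, |s| * K < 1 → ContDiff ℝ ∞ (fun x => F (s, x)) := fun s hs =>
    contDiff_iff_contDiffAt.2 fun x => (hsmall s x hs).comp x (by fun_prop)
  have hadd : ∀ s t, ContDiff ℝ ∞ (fun x => F (s, x)) → ContDiff ℝ ∞ (fun x => F (t, x)) →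
      ContDiff ℝ ∞ (fun x => F (s + t, x)) := by
    intro s t h₁ h₂
    simp only [hgroup]
    exact h₁.comp h₂
  have hnat : ∀ (n : ℕ) (s : ℝ), |s| * K < 1 → ContDiff ℝ ∞ (fun x => F (n * s, x)) := by
    intro n s hs
    induction n with
    | zero => simpa using hslice 0 (by simp)
    | succ n ih =>
      have : ((n + 1 : ℕ) : ℝ) * s = n * s + s := by push_cast; ring
      simp only [this]
      exact hadd _ _ ih (hslice s hs)
  have hall : ∀ t, ContDiff ℝ ∞ (fun x => F (t, x)) := by
    intro t
    obtain ⟨n, hn⟩ := exists_nat_gt (|t| * K)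
    have hn0 : (0 : ℝ) < n := lt_of_le_of_lt (by positivity) hn
    have : t = n * (t / n) := by field_simp
    rw [this]
    refine hnat n _ ?_
    rw [abs_div, abs_of_pos hn0, div_mul_eq_mul_div, div_lt_one hn0]
    exact hn
  refine ⟨F, ?_, hc0, fun t x => hc x t, hgroup, fun c' hc' t => ?_⟩
  · refine contDiff_iff_contDiffAt.2 fun q => ?_
    obtain ⟨t, x⟩ := q
    have : F = fun q => F (q.1 - t, F (t, q.2)) := by
      ext q
      rw [← hgroup, sub_add_cancel]
    rw [this]
    refine ContDiffAt.comp (t, x) (g := F) (f := fun q : ℝ × E => (q.1 - t, F (t, q.2))) ?_ ?_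
    · simpa using hsmall 0 _ (by simp)
    · exact (contDiffAt_fst.sub contDiffAt_const).prodMk ((hall t).comp contDiff_snd).contDiffAt
  · exact congrFun (huniq c' (c (c' 0)) hc' (hc _) (by simp [hc0])) t

end SmoothFlow

noncomputable section LocalToGlobal
open Set Filter Topology
open scoped ContDiff Manifold

variable {E F : Type} [NormedAddCommGroup E] [NormedSpace ℝ E] [FiniteDimensional ℝ E]
  [NormedAddCommGroup F] [NormedSpace ℝ F]

theorem exists_contDiff_cutoff {K U : Set E} (hK : IsCompact K) (hU : IsOpen U) (hKU : K ⊆ U) :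
    ∃ χ : E → ℝ, ContDiff ℝ ∞ χ ∧ HasCompactSupport χ ∧ tsupport χ ⊆ U ∧
      (∀ᶠ x in 𝓝ˢ K, χ x = 1) ∧ ∀ x, χ x ∈ Icc (0 : ℝ) 1 := by
  obtain ⟨L, hL, hKL, hLU⟩ := exists_compact_between hK hU hKU
  obtain ⟨χ, h0, h1, h2⟩ := exists_contMDiffMap_zero_one_nhds_of_isClosed (n := ⊤) 𝓘(ℝ, E)
    (isOpen_interior (s := L)).isClosed_compl hK.isClosed
    (by rwa [← subset_compl_iff_disjoint_left, compl_compl])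
  have hsupp : tsupport χ ⊆ L := by
    refine closure_minimal (fun x hx => ?_) hL.isClosed
    by_contra hxL
    exact hx (h0.self_of_nhdsSet x fun h => hxL (interior_subset h))
  exact ⟨χ, χ.contMDiff.contDiff, hL.of_isClosed_subset (isClosed_tsupport _) hsupp,
    hsupp.trans hLU, h1, h2⟩

/-- Smooth maps near a compact set extend to compactly supported smooth maps. -/
theorem exists_contDiff_eventuallyEq_nhdsSet {K U : Set E} (hK : IsCompact K) (hU : IsOpen U)
    (hKU : K ⊆ U) {f : E → F} (hf : ContDiffOn ℝ ∞ f U) :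
    ∃ g : E → F, ContDiff ℝ ∞ g ∧ HasCompactSupport g ∧ ∀ᶠ x in 𝓝ˢ K, g x = f x := by
  obtain ⟨χ, h1, h2, h3, h4, -⟩ := exists_contDiff_cutoff hK hU hKU
  refine ⟨fun x => χ x • f x, contDiff_iff_contDiffAt.2 fun x => ?_, h2.smul_right, ?_⟩
  · by_cases hx : x ∈ U
    · exact h1.contDiffAt.smul (hf.contDiffAt (hU.mem_nhds hx))
    · have : (fun x => χ x • f x) =ᶠ[𝓝 x] fun _ => 0 := by
        filter_upwards [(notMem_tsupport_iff_eventuallyEq.1 fun h => hx (h3 h))] with y hy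
        simp [hy]
      exact contDiffAt_const.congr_of_eventuallyEq this
  · filter_upwards [h4] with x hx
    simp [hx]

/-- Germs of smooth maps extend to smooth maps. -/
theorem exists_contDiff_eventuallyEq {f : E → F} {a : E}
    (hf : ∀ᶠ x in 𝓝 a, ContDiffAt ℝ ∞ f x) :
    ∃ g : E → F, ContDiff ℝ ∞ g ∧ g =ᶠ[𝓝 a] f := by
  obtain ⟨U, hU, hUo, haU⟩ := eventually_nhds_iff.1 hf
  obtain ⟨g, h1, -, h2⟩ := exists_contDiff_eventuallyEq_nhdsSet (isCompact_singleton (x := a)) hUo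
    (singleton_subset_iff.2 haU) (f := f) fun x hx => (hU x hx).contDiffWithinAt
  exact ⟨g, h1, by rwa [nhdsSet_singleton] at h2⟩

/-- Germs of positive smooth functions extend to positive smooth functions. -/
theorem exists_contDiff_pos_eventuallyEq {f : E → ℝ} {a : E}
    (hf : ContDiff ℝ ∞ f) (ha : 0 < f a) :
    ∃ g : E → ℝ, ContDiff ℝ ∞ g ∧ g =ᶠ[𝓝 a] f ∧ ∀ x, 0 < g x := by
  obtain ⟨χ, h1, -, h3, h4, h5⟩ := exists_contDiff_cutoff (isCompact_singleton (x := a))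
    (isOpen_Ioi.preimage hf.continuous : IsOpen (f ⁻¹' Ioi 0)) (singleton_subset_iff.2 ha)
  refine ⟨fun x => χ x * f x + (1 - χ x), by fun_prop, ?_, fun x => ?_⟩
  · rw [nhdsSet_singleton] at h4
    filter_upwards [h4] with x hx
    simp [hx]
  · by_cases hx : χ x = 0
    · simp [hx]
    · have hfx : 0 < f x := h3 (subset_tsupport _ hx)
      have hχ : 0 < χ x := lt_of_le_of_ne (h5 x).1 (Ne.symm hx)
      have := (h5 x).2
      nlinarith [mul_pos hχ hfx]

/-- The inverse function theorem, with globally defined smooth local inverse. -/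
theorem exists_contDiff_localInverse [FiniteDimensional ℝ F] {f : E → F} {a : E}
    (hf : ContDiff ℝ ∞ f) (hinv : (fderiv ℝ f a).IsInvertible) :
    ∃ g : F → E, ContDiff ℝ ∞ g ∧ g (f a) = a ∧ (∀ᶠ y in 𝓝 (f a), f (g y) = y) ∧
      ∀ᶠ x in 𝓝 a, g (f x) = x := by
  have hd : ∀ x, HasFDerivAt f (fderiv ℝ f x) x := fun x =>
    (hf.differentiable (by simp) x).hasFDerivAt
  obtain ⟨A, hA⟩ := hinv
  have hda : HasFDerivAt f (A : E →L[ℝ] F) a := by rw [hA]; exact hd a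
  let Λ := hf.contDiffAt.toOpenPartialHomeomorph f hda (by simp)
  have haΛ : a ∈ Λ.source := hf.contDiffAt.mem_toOpenPartialHomeomorph_source hda (by simp)
  have hfaΛ : f a ∈ Λ.target := hf.contDiffAt.image_mem_toOpenPartialHomeomorph_target hda (by simp)
  have hsymm : Λ.symm (f a) = a := Λ.left_inv haΛ
  have hinv' : ∀ᶠ x in 𝓝 a, (fderiv ℝ f x).IsInvertible := by
    have := (hf.continuous_fderiv (by simp)).continuousAt (x := a)
      |>.eventually (hA ▸ ContinuousLinearEquiv.nhds A)
    exact this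
  have hcs : ContinuousAt Λ.symm (f a) := Λ.symm.continuousAt hfaΛ
  have hsm : ∀ᶠ y in 𝓝 (f a), ContDiffAt ℝ ∞ Λ.symm y := by
    have h1 : ∀ᶠ y in 𝓝 (f a), (fderiv ℝ f (Λ.symm y)).IsInvertible :=
      hcs.eventually (p := fun x => (fderiv ℝ f x).IsInvertible) (by rwa [hsymm])
    filter_upwards [h1, Λ.open_target.mem_nhds hfaΛ] with y hy hyt
    obtain ⟨A', hA'⟩ := hy
    exact Λ.contDiffAt_symm hyt (f₀' := A') (by rw [hA']; exact hd _) hf.contDiffAt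
  obtain ⟨g, hg, hgΛ⟩ := exists_contDiff_eventuallyEq hsm
  refine ⟨g, hg, by rw [hgΛ.eq_of_nhds, hsymm], ?_, ?_⟩
  · filter_upwards [hgΛ, Λ.open_target.mem_nhds hfaΛ] with y hy hyt
    rw [hy]
    exact Λ.right_inv hyt
  · filter_upwards [hf.continuous.continuousAt.eventually hgΛ,
      Λ.open_source.mem_nhds haΛ] with x hx hxs
    rw [hx]
    exact Λ.left_inv hxs

theorem isInvertible_of_injective [FiniteDimensional ℝ F]
    (hdim : Module.finrank ℝ E = Module.finrank ℝ F) {A : E →L[ℝ] F}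
    (hA : Function.Injective A) : A.IsInvertible := by
  refine ⟨(LinearMap.linearEquivOfInjective A.toLinearMap hA hdim).toContinuousLinearEquiv, ?_⟩
  ext x
  rfl

end LocalToGlobal

noncomputable section EvenFunctions
open Set Filter Topology MeasureTheory FourierTransform
open scoped ContDiff Nat

/-- There is a smooth `C` with `C (x ^ 2) = cos x`. -/
theorem exists_contDiff_cos_sqrt : ∃ C : ℝ → ℝ, ContDiff ℝ ∞ C ∧ ∀ x, C (x ^ 2) = Real.cos x := by
  let c : ℕ → ℝ := fun n => (-1) ^ n / (2 * n)!
  have hrad : (FormalMultilinearSeries.ofScalars ℝ c).radius = ⊤ := by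
    refine FormalMultilinearSeries.ofScalars_radius_eq_top_of_tendsto ℝ c
      (Eventually.of_forall fun n => by simp [c, Nat.factorial_ne_zero]) ?_
    have h1 : ∀ n : ℕ, ‖c n.succ‖ / ‖c n‖ = 1 / (((2 * n + 2 : ℕ) : ℝ) * (2 * n + 1 : ℕ)) := by
      intro n
      have h2 : (2 * n.succ)! = (2 * n + 2) * ((2 * n + 1) * (2 * n)!) := by
        rw [Nat.mul_succ, Nat.factorial_succ, Nat.factorial_succ]
      have h3 : ((2 * n)! : ℝ) ≠ 0 := by exact_mod_cast Nat.factorial_ne_zero _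
      simp only [c, norm_div, norm_pow, norm_neg, norm_one, one_pow, h2]
      push_cast
      simp only [norm_mul, Real.norm_natCast]
      rw [Real.norm_of_nonneg (by positivity), Real.norm_of_nonneg (by positivity)]
      field_simp
    simp only [h1]
    refine squeeze_zero (fun n => by positivity) (fun n => ?_)
      tendsto_one_div_add_atTop_nhds_zero_nat
    push_cast
    gcongr
    nlinarith [n.cast_nonneg (α := ℝ)]
  have hball := (FormalMultilinearSeries.ofScalars ℝ c).hasFPowerSeriesOnBall (by simp [hrad])
  rw [hrad] at hball
  refine ⟨_, contDiff_iff_contDiffAt.2 fun x =>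
    (hball.analyticAt_of_mem (by simp) : AnalyticAt ℝ _ x).contDiffAt, fun x => ?_⟩
  have h1 := FormalMultilinearSeries.ofScalars_sum_eq c (x ^ 2)
  rw [FormalMultilinearSeries.ofScalarsSum] at h1
  rw [h1, ← (Real.hasSum_cos x).tsum_eq]
  refine tsum_congr fun n => ?_
  simp only [c, smul_eq_mul, pow_mul]
  ring

/-- There is a smooth `D` with bounded derivatives and `D (x ^ 2) = cos x`. -/
theorem exists_bounded_contDiff_cos_sqrt : ∃ D : ℝ → ℝ, ContDiff ℝ ∞ D ∧
    (∀ x, D (x ^ 2) = Real.cos x) ∧ ∀ k, ∃ M, ∀ s, |iteratedDeriv k D s| ≤ M := by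
  obtain ⟨C, hC, hcos⟩ := exists_contDiff_cos_sqrt
  have hCk : ∀ k, ContDiff ℝ ∞ (iteratedDeriv k C) := fun k => by
    rw [iteratedDeriv_eq_iterate]
    exact hC.iterate_deriv k
  have hder : ∀ k s, HasDerivAt (iteratedDeriv k C) (iteratedDeriv (k + 1) C s) s := by
    intro k s
    rw [iteratedDeriv_succ]
    exact ((hCk k).differentiable (by simp) s).hasDerivAt
  have h0 : ∀ x, iteratedDeriv 1 C (x ^ 2) * (2 * x) = -Real.sin x := by
    intro x
    have h1 : HasDerivAt (fun x => C (x ^ 2)) (iteratedDeriv 1 C (x ^ 2) * (2 * x)) x := by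
      have := hder 0 (x ^ 2)
      rw [iteratedDeriv_zero] at this
      convert! HasDerivAt.comp (h₂ := C) (h := fun x => x ^ 2) x this (hasDerivAt_pow 2 x) using 1
      simp
    simp only [hcos] at h1
    exact h1.unique (Real.hasDerivAt_cos x)
  have h00 : ∀ x, iteratedDeriv 2 C (x ^ 2) * (2 * x) * (2 * x) + iteratedDeriv 1 C (x ^ 2) * 2
      = -Real.cos x := by
    intro x
    have h1 : HasDerivAt (fun x => iteratedDeriv 1 C (x ^ 2) * (2 * x))
        (iteratedDeriv 2 C (x ^ 2) * (2 * x) * (2 * x) + iteratedDeriv 1 C (x ^ 2) * 2) x := by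
      have h2 := (HasDerivAt.comp (h₂ := iteratedDeriv 1 C) (h := fun x => x ^ 2) x
        (hder 1 (x ^ 2)) (hasDerivAt_pow 2 x)).mul ((hasDerivAt_id x).const_mul 2)
      convert! h2 using 1
      simp
    simp only [h0] at h1
    exact h1.unique (Real.hasDerivAt_sin x).neg
  have hode : ∀ k : ℕ, ∀ s : ℝ, 0 < s → 4 * s * iteratedDeriv (k + 2) C s +
      (4 * k + 2) * iteratedDeriv (k + 1) C s + iteratedDeriv k C s = 0 := by
    intro k
    induction k with
    | zero =>
      intro s hs
      have h1 := h00 (√s)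
      have h2 := hcos (√s)
      rw [Real.sq_sqrt hs.le] at h1 h2
      rw [iteratedDeriv_zero, h2]
      have h3 := Real.mul_self_sqrt hs.le
      push_cast
      linear_combination h1 - 4 * iteratedDeriv 2 C s * h3
    | succ k ih =>
      intro s hs
      have h1 : HasDerivAt (fun s => 4 * s * iteratedDeriv (k + 2) C s +
          (4 * k + 2) * iteratedDeriv (k + 1) C s + iteratedDeriv k C s)
          ((4 * 1) * iteratedDeriv (k + 2) C s + 4 * s * iteratedDeriv (k + 3) C s +
          (4 * k + 2) * iteratedDeriv (k + 2) C s + iteratedDeriv (k + 1) C s) s :=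
        ((((hasDerivAt_id s).const_mul 4).mul (hder (k + 2) s)).add
          ((hder (k + 1) s).const_mul _)).add (hder k s)
      have h2 : (fun s => 4 * s * iteratedDeriv (k + 2) C s +
          (4 * k + 2) * iteratedDeriv (k + 1) C s + iteratedDeriv k C s) =ᶠ[𝓝 s] fun _ => 0 := by
        filter_upwards [lt_mem_nhds hs] with t ht using ih t ht
      have h3 := (h1.congr_of_eventuallyEq h2.symm).unique (hasDerivAt_const s 0)
      push_cast
      linear_combination h3
  have hbdd : ∀ k : ℕ, (∃ M, ∀ s, 1 ≤ s → |iteratedDeriv k C s| ≤ M) ∧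
      ∃ M, ∀ s, 1 ≤ s → |iteratedDeriv (k + 1) C s| ≤ M := by
    intro k
    induction k with
    | zero =>
      refine ⟨⟨1, fun s hs => ?_⟩, ⟨1, fun s hs => ?_⟩⟩
      · rw [iteratedDeriv_zero, ← Real.sq_sqrt (zero_le_one.trans hs), hcos]
        exact Real.abs_cos_le_one _
      · have h1 := h0 (√s)
        rw [Real.sq_sqrt (zero_le_one.trans hs)] at h1
        have h2 : 1 ≤ √s := Real.one_le_sqrt.2 hs
        have h3 := Real.abs_sin_le_one (√s)
        rw [← abs_neg, ← h1, abs_mul, abs_of_pos (by linarith : 0 < 2 * √s)] at h3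
        have := abs_nonneg (iteratedDeriv 1 C s)
        simp only [zero_add]
        nlinarith
    | succ k ih =>
      obtain ⟨⟨M, hM⟩, M', hM'⟩ := ih
      refine ⟨⟨M', hM'⟩, (4 * k + 2) * M' + M, fun s hs => ?_⟩
      have h1 := hode k s (by linarith)
      have h2 : 4 * s * iteratedDeriv (k + 2) C s =
          -((4 * k + 2) * iteratedDeriv (k + 1) C s + iteratedDeriv k C s) := by linarith
      have h3 : |4 * s * iteratedDeriv (k + 2) C s| ≤ (4 * k + 2) * M' + M := by
        rw [h2, abs_neg]
        refine (abs_add_le _ _).trans (add_le_add ?_ (hM s hs))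
        rw [abs_mul, abs_of_nonneg (by positivity)]
        gcongr
        exact hM' s hs
      rw [abs_mul, abs_of_nonneg (by linarith)] at h3
      have := abs_nonneg (iteratedDeriv (k + 2) C s)
      change |iteratedDeriv (k + 2) C s| ≤ _
      nlinarith
  let χ : ℝ → ℝ := fun s => Real.smoothTransition (s + 1)
  have hχ : ContDiff ℝ ∞ χ := Real.smoothTransition.contDiff.comp (by fun_prop)
  refine ⟨fun s => χ s * C s, hχ.mul hC, fun x => ?_, fun k => ?_⟩
  · have : χ (x ^ 2) = 1 := Real.smoothTransition.one_of_one_le (by nlinarith [sq_nonneg x])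
    simp only [this, hcos, one_mul]
  · obtain ⟨⟨M, hM⟩, -⟩ := hbdd k
    have hcont : Continuous (iteratedDeriv k fun s => χ s * C s) :=
      (hχ.mul hC).continuous_iteratedDeriv k (by exact_mod_cast le_top)
    obtain ⟨M', hM'⟩ := (isCompact_Icc (a := (-2 : ℝ)) (b := 1)).exists_bound_of_continuousOn
      hcont.continuousOn
    refine ⟨max (max M M') 0, fun s => ?_⟩
    rcases lt_or_ge s (-2) with hs | hs
    · have : (fun s => χ s * C s) =ᶠ[𝓝 s] fun _ => 0 := by
        filter_upwards [gt_mem_nhds hs] with t ht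
        simp only [χ, Real.smoothTransition.zero_of_nonpos (show t + 1 ≤ 0 by linarith), zero_mul]
      rw [this.iteratedDeriv_eq]
      simp
    rcases le_or_gt s 1 with hs1 | hs1
    · exact (hM' s ⟨hs, hs1⟩).trans ((le_max_right _ _).trans (le_max_left _ _))
    · have : (fun s => χ s * C s) =ᶠ[𝓝 s] C := by
        filter_upwards [lt_mem_nhds hs1] with t ht
        simp only [χ, Real.smoothTransition.one_of_one_le (show 1 ≤ t + 1 by linarith), one_mul]
      rw [this.iteratedDeriv_eq]
      exact (hM s hs1.le).trans ((le_max_left _ _).trans (le_max_left _ _))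

theorem contDiff_integral_mul_comp_sq_mul (n : ℕ) : ∀ {h D : ℝ → ℝ}, Continuous h →
    (∀ k : ℕ, Integrable fun ξ => ξ ^ k * h ξ) → ContDiff ℝ ∞ D →
    (∀ k, ∃ M, ∀ s, |iteratedDeriv k D s| ≤ M) →
    ContDiff ℝ n fun t => ∫ ξ, h ξ * D (ξ ^ 2 * t) := by
  have key : ∀ {h D : ℝ → ℝ}, Continuous h → (∀ k : ℕ, Integrable fun ξ => ξ ^ k * h ξ) →
      ContDiff ℝ ∞ D → (∀ k, ∃ M, ∀ s, |iteratedDeriv k D s| ≤ M) → ∀ t,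
      HasDerivAt (fun t => ∫ ξ, h ξ * D (ξ ^ 2 * t))
        (∫ ξ, ξ ^ 2 * h ξ * deriv D (ξ ^ 2 * t)) t := by
    intro h D hc hint hD hM t
    obtain ⟨M0, hM0⟩ := hM 0
    obtain ⟨M1, hM1⟩ := hM 1
    have hD' : Continuous (deriv D) := hD.continuous_deriv (by simp)
    have hDc : Continuous D := hD.continuous
    refine (hasDerivAt_integral_of_dominated_loc_of_deriv_le (μ := volume) (x₀ := t) (s := univ)
      (F := fun t ξ => h ξ * D (ξ ^ 2 * t)) (F' := fun t ξ => ξ ^ 2 * h ξ * deriv D (ξ ^ 2 * t))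
      (bound := fun ξ => ‖ξ ^ 2 * h ξ‖ * M1) univ_mem ?_ ?_ ?_ ?_ ?_ ?_).2
    · exact Eventually.of_forall fun t => (by fun_prop : Continuous _).aestronglyMeasurable
    · have h1 : Integrable h := by simpa using hint 0
      refine h1.mul_bdd (c := M0) (by fun_prop : Continuous _).aestronglyMeasurable ?_
      exact Eventually.of_forall fun ξ => by simpa using hM0 (ξ ^ 2 * t)
    · exact (by fun_prop : Continuous _).aestronglyMeasurable
    · refine Eventually.of_forall fun ξ t _ => ?_
      rw [norm_mul]
      gcongr
      simpa using hM1 (ξ ^ 2 * t)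
    · exact (hint 2).norm.mul_const _
    · refine Eventually.of_forall fun ξ t _ => ?_
      have h1 := (hD.differentiable (by simp) (ξ ^ 2 * t)).hasDerivAt.comp t
        ((hasDerivAt_id t).const_mul (ξ ^ 2))
      convert! h1.const_mul (h ξ) using 1
      ring
  induction n with
  | zero =>
    intro h D hc hint hD hM
    exact contDiff_zero.2
      (continuous_iff_continuousAt.2 fun t => (key hc hint hD hM t).continuousAt)
  | succ n ih =>
    intro h D hc hint hD hM
    push_cast
    rw [contDiff_succ_iff_deriv]
    refine ⟨fun t => (key hc hint hD hM t).differentiableAt, by simp, ?_⟩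
    have : deriv (fun t => ∫ ξ, h ξ * D (ξ ^ 2 * t)) =
        fun t => ∫ ξ, ξ ^ 2 * h ξ * deriv D (ξ ^ 2 * t) :=
      funext fun t => (key hc hint hD hM t).deriv
    rw [this]
    refine ih (by fun_prop) (fun k => ?_) (by simpa using hD.iterate_deriv 1) fun k => ?_
    · simpa [pow_add, mul_assoc] using hint (k + 2)
    · simpa [iteratedDeriv_succ'] using hM (k + 1)

/-- Whitney's theorem: a smooth even function is a smooth function of the square. -/
theorem exists_contDiff_comp_sq {f : ℝ → ℝ} (hf : ContDiff ℝ ∞ f)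
    (heven : ∀ᶠ x in 𝓝 0, f (-x) = f x) :
    ∃ g : ℝ → ℝ, ContDiff ℝ ∞ g ∧ ∀ᶠ x in 𝓝 0, f x = g (x ^ 2) := by
  obtain ⟨D, hD, hDcos, hDM⟩ := exists_bounded_contDiff_cos_sqrt
  obtain ⟨ε, hε, hball⟩ := Metric.eventually_nhds_iff_ball.1 heven
  let χ : ContDiffBump (0 : ℝ) := ⟨ε / 2, ε, by positivity, by linarith⟩
  let F : ℝ → ℂ := fun x => ((χ x * f x : ℝ) : ℂ)
  have hFs : ContDiff ℝ ∞ F := Complex.ofRealCLM.contDiff.comp (χ.contDiff.mul hf)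
  have hFeven : ∀ x, F (-x) = F x := by
    intro x
    simp only [F, χ.neg]
    by_cases hx : x ∈ Metric.ball (0 : ℝ) ε
    · rw [hball x hx]
    · rw [χ.zero_of_le_dist (by simpa using hx)]
      simp
  have hFc : HasCompactSupport F := by
    refine HasCompactSupport.intro (isCompact_closedBall (0 : ℝ) ε) fun x hx => ?_
    have : ε ≤ dist x 0 := by
      simp only [Metric.mem_closedBall, not_le] at hx
      exact hx.le
    simp [F, χ.zero_of_le_dist this]
  let S : SchwartzMap ℝ ℂ := hFc.toSchwartzMap hFs
  let h : ℝ → ℝ := fun ξ => ((𝓕 S) ξ).re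
  have hinv : ∀ x, F x = ∫ ξ, Complex.exp (↑(2 * Real.pi * (ξ * x)) * Complex.I) * (𝓕 S) ξ := by
    intro x
    have h1 : 𝓕⁻ (𝓕 S) = S := FourierTransform.fourierInv_fourier_eq S
    have h2 := congrArg (fun T : SchwartzMap ℝ ℂ => T x) h1
    simp only [SchwartzMap.fourierInv_coe] at h2
    rw [Real.fourierInv_eq'] at h2
    rw [show F x = S x from rfl, ← h2]
    refine integral_congr_ae (Eventually.of_forall fun ξ => ?_)
    simp [mul_comm x ξ]
  have hSint : ∀ x, Integrable fun ξ =>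
      Complex.exp (↑(2 * Real.pi * (ξ * x)) * Complex.I) * (𝓕 S) ξ := by
    intro x
    refine ((𝓕 S).integrable (μ := volume)).bdd_mul (c := 1)
      (by fun_prop : Continuous _).aestronglyMeasurable (Eventually.of_forall fun ξ => ?_)
    rw [Complex.norm_exp_ofReal_mul_I]
  have hcosint : ∀ x, χ x * f x = ∫ ξ, h ξ * D (ξ ^ 2 * ((2 * Real.pi * x) ^ 2)) := by
    intro x
    have h1 : F x + F (-x) = ∫ ξ, 2 * (Real.cos (2 * Real.pi * (ξ * x)) : ℂ) * (𝓕 S) ξ := by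
      rw [hinv x, hinv (-x), ← integral_add (hSint x) (hSint (-x))]
      refine integral_congr_ae (Eventually.of_forall fun ξ => ?_)
      simp only [Complex.ofReal_cos, Complex.cos]
      push_cast
      ring_nf
    rw [hFeven] at h1
    have h2 : (F x + F x).re = 2 * (χ x * f x) := by
      simp only [F, Complex.add_re, Complex.ofReal_re]
      ring
    have hint : Integrable fun ξ => 2 * (Real.cos (2 * Real.pi * (ξ * x)) : ℂ) * (𝓕 S) ξ := by
      refine (((hSint x).add (hSint (-x)))).congr (Eventually.of_forall fun ξ => ?_)
      simp only [Pi.add_apply, Complex.ofReal_cos, Complex.cos]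
      push_cast
      ring_nf
    have h3 := congrArg Complex.re h1
    rw [h2] at h3
    have h4 := integral_re hint
    simp only [RCLike.re_to_complex] at h4
    rw [← h4] at h3
    have h5 : ∀ ξ, (2 * (Real.cos (2 * Real.pi * (ξ * x)) : ℂ) * (𝓕 S) ξ).re =
        2 * (h ξ * D (ξ ^ 2 * ((2 * Real.pi * x) ^ 2))) := by
      intro ξ
      rw [show ξ ^ 2 * ((2 * Real.pi * x) ^ 2) = (2 * Real.pi * (ξ * x)) ^ 2 by ring, hDcos]
      rw [mul_assoc, show (2 : ℂ) = ((2 : ℝ) : ℂ) by norm_num, Complex.re_ofReal_mul,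
        Complex.re_ofReal_mul]
      ring
    simp only [h5] at h3
    rw [integral_const_mul] at h3
    linarith
  let g₀ : ℝ → ℝ := fun t => ∫ ξ, h ξ * D (ξ ^ 2 * t)
  have hg₀ : ContDiff ℝ ∞ g₀ := by
    have hh : Continuous h := Complex.continuous_re.comp (𝓕 S).continuous
    refine contDiff_infty.2 fun n => contDiff_integral_mul_comp_sq_mul n hh (fun k => ?_) hD hDM
    refine ((𝓕 S).integrable_pow_mul volume k).mono
      (by fun_prop : Continuous _).aestronglyMeasurable
      (Eventually.of_forall fun ξ => ?_)
    simp only [norm_mul, norm_pow, norm_norm]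
    gcongr
    exact Complex.abs_re_le_norm _
  refine ⟨fun t => g₀ ((2 * Real.pi) ^ 2 * t), hg₀.comp (by fun_prop), ?_⟩
  filter_upwards [Metric.closedBall_mem_nhds (0 : ℝ) (show 0 < ε / 2 by positivity)] with x hx
  have h1 := hcosint x
  rw [χ.one_of_mem_closedBall hx, one_mul] at h1
  rw [h1, mul_pow]

end EvenFunctions

noncomputable section PlaneMorse
open Set Filter Topology
open scoped ContDiff

/-- The determinant of two plane vectors. -/
def planeDet (u v : ℂ) : ℝ := u.re * v.im - u.im * v.re

theorem planeDet_apply (A : ℂ →L[ℝ] ℂ) (u v : ℂ) :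
    planeDet (A u) (A v) = planeDet (A 1) (A Complex.I) * planeDet u v := by
  have h : ∀ w : ℂ, A w = w.re • A 1 + w.im • A Complex.I := by
    intro w
    rw [← map_smul, ← map_smul, ← map_add]
    congr 1
    apply Complex.ext <;> simp
  rw [h u, h v]
  simp [planeDet]
  ring

theorem isInvertible_of_planeDet_ne_zero {A : ℂ →L[ℝ] ℂ}
    (hA : planeDet (A 1) (A Complex.I) ≠ 0) : A.IsInvertible := by
  refine isInvertible_of_injective rfl ((injective_iff_map_eq_zero A).2 fun u hu => ?_)
  have h1 := planeDet_apply A u (Complex.I * u)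
  rw [hu] at h1
  have h2 : planeDet u (Complex.I * u) = u.re ^ 2 + u.im ^ 2 := by simp [planeDet]; ring
  rw [h2] at h1
  have h3 : u.re ^ 2 + u.im ^ 2 = 0 := by
    have : planeDet (A 1) (A Complex.I) * (u.re ^ 2 + u.im ^ 2) = 0 := by
      rw [← h1]; simp [planeDet]
    exact (mul_eq_zero.1 this).resolve_left hA
  apply Complex.ext <;> simp <;> nlinarith [sq_nonneg u.re, sq_nonneg u.im]

/-- Second order Taylor formula with integral remainder. -/
theorem taylor_two_integral {E : Type} [NormedAddCommGroup E] [NormedSpace ℝ E] {h : E → ℝ}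
    (hh : ContDiff ℝ ∞ h) (u : E) :
    ∫ t in (0 : ℝ)..1, (1 - t) * fderiv ℝ (fderiv ℝ h) (t • u) u u =
      h u - h 0 - fderiv ℝ h 0 u := by
  have hh' : ContDiff ℝ ∞ (fderiv ℝ h) := hh.fderiv_right (by simp)
  have hh'' : Continuous (fderiv ℝ (fderiv ℝ h)) := hh'.continuous_fderiv (by simp)
  have hl : ∀ t : ℝ, HasDerivAt (fun t : ℝ => t • u) u t := fun t => by
    simpa using (hasDerivAt_id t).smul_const u
  have h1 : ∀ t : ℝ, HasDerivAt (fun t : ℝ => h (t • u)) (fderiv ℝ h (t • u) u) t := fun t =>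
    ((hh.differentiable (by simp) _).hasFDerivAt).comp_hasDerivAt t (hl t)
  have h2 : ∀ t : ℝ, HasDerivAt (fun t : ℝ => fderiv ℝ h (t • u) u)
      (fderiv ℝ (fderiv ℝ h) (t • u) u u) t := fun t => by
    have := ((hh'.differentiable (by simp) (t • u)).hasFDerivAt).comp_hasDerivAt t (hl t)
    simpa using this.clm_apply (hasDerivAt_const t u)
  have h3 : ∀ t : ℝ, HasDerivAt (fun t : ℝ => (1 - t) * fderiv ℝ h (t • u) u + h (t • u))
      ((1 - t) * fderiv ℝ (fderiv ℝ h) (t • u) u u) t := fun t => by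
    convert! (((hasDerivAt_id t).const_sub 1).mul (h2 t)).add (h1 t) using 1
    simp
  rw [intervalIntegral.integral_eq_sub_of_hasDerivAt (fun t _ => h3 t)
    (Continuous.intervalIntegrable (by fun_prop) _ _)]
  simp
  ring

/-- The Morse lemma at a nondegenerate minimum in the plane. -/
theorem exists_morse_chart {h : ℂ → ℝ} (hh : ContDiff ℝ ∞ h) (h0 : fderiv ℝ h 0 = 0)
    (hpos : ∀ u : ℂ, u ≠ 0 → 0 < fderiv ℝ (fderiv ℝ h) 0 u u) :
    ∃ m : ℂ → ℂ, ContDiff ℝ ∞ m ∧ m 0 = 0 ∧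
      0 < planeDet (fderiv ℝ m 0 1) (fderiv ℝ m 0 Complex.I) ∧
      ∀ᶠ u in 𝓝 0, h u = h 0 + ‖m u‖ ^ 2 := by
  have hh' : ContDiff ℝ ∞ (fderiv ℝ h) := hh.fderiv_right (by simp)
  have hh'' : ContDiff ℝ ∞ (fderiv ℝ (fderiv ℝ h)) := hh'.fderiv_right (by simp)
  let a : ℂ → ℂ → ℂ → ℝ := fun v w u =>
    ∫ t in (0 : ℝ)..1, (1 - t) * fderiv ℝ (fderiv ℝ h) (t • u) v w
  have ha : ∀ v w, ContDiff ℝ ∞ (a v w) := by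
    intro v w
    refine contDiff_intervalIntegral_of_contDiff
      (f := fun q : ℂ × ℝ => (1 - q.2) * fderiv ℝ (fderiv ℝ h) (q.2 • q.1) v w) ?_ zero_le_one
    refine ContDiff.mul (by fun_prop) (ContDiff.clm_apply (ContDiff.clm_apply ?_ contDiff_const)
      contDiff_const)
    exact hh''.comp (contDiff_snd.smul contDiff_fst)
  have ha0 : ∀ v w, a v w 0 = fderiv ℝ (fderiv ℝ h) 0 v w / 2 := by
    intro v w
    simp only [a, smul_zero, intervalIntegral.integral_mul_const]
    have : ∫ t in (0 : ℝ)..1, (1 - t) = 1 / 2 := by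
      rw [intervalIntegral.integral_sub (by simp) (by simp)]
      simp
      norm_num
    rw [this]
    ring
  have hsymm : ∀ v w u, a v w u = a w v u := by
    intro v w u
    refine intervalIntegral.integral_congr fun t _ => ?_
    have h1 : IsSymmSndFDerivAt ℝ h (t • u) :=
      (contDiff_infty.1 hh 2).contDiffAt.isSymmSndFDerivAt (by simp)
    simp only [h1.eq v w]
  have hrep : ∀ u : ℂ, h u = h 0 + (a 1 1 u * u.re ^ 2 + 2 * a 1 Complex.I u * (u.re * u.im) +
      a Complex.I Complex.I u * u.im ^ 2) := by
    intro u
    have h1 := taylor_two_integral hh u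
    have h2 : ∫ t in (0 : ℝ)..1, (1 - t) * fderiv ℝ (fderiv ℝ h) (t • u) u u =
        a 1 1 u * u.re ^ 2 + a 1 Complex.I u * (u.re * u.im) + a Complex.I 1 u * (u.re * u.im) +
        a Complex.I Complex.I u * u.im ^ 2 := by
      have hint : ∀ v w (k : ℝ), IntervalIntegrable (fun t : ℝ =>
          (1 - t) * fderiv ℝ (fderiv ℝ h) (t • u) v w * k) MeasureTheory.volume 0 1 := by
        intro v w k
        refine Continuous.intervalIntegrable ?_ _ _
        have := hh''.continuous
        fun_prop
      simp only [a, ← intervalIntegral.integral_mul_const]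
      rw [← intervalIntegral.integral_add (hint _ _ _) (hint _ _ _),
        ← intervalIntegral.integral_add ((hint _ _ _).add (hint _ _ _)) (hint _ _ _),
        ← intervalIntegral.integral_add (((hint _ _ _).add (hint _ _ _)).add (hint _ _ _))
          (hint _ _ _)]
      refine intervalIntegral.integral_congr fun t _ => ?_
      have hu : u = u.re • (1 : ℂ) + u.im • Complex.I := by apply Complex.ext <;> simp
      have : ∀ A : ℂ →L[ℝ] ℂ →L[ℝ] ℝ, A u u = A 1 1 * u.re ^ 2 + A 1 Complex.I * (u.re * u.im) +
          A Complex.I 1 * (u.re * u.im) + A Complex.I Complex.I * u.im ^ 2 := by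
        intro A
        conv_lhs => rw [hu]
        simp only [map_add, map_smul, add_apply, smul_apply, smul_eq_mul]
        ring
      simp only [this]
      ring
    rw [h2, h0, hsymm Complex.I 1] at h1
    simp only [zero_apply] at h1
    linarith
  have hA0 : 0 < a 1 1 0 := by rw [ha0]; exact half_pos (hpos 1 one_ne_zero)
  obtain ⟨A, hA, hAa, hApos⟩ := exists_contDiff_pos_eventuallyEq (ha 1 1) hA0
  let d : ℂ → ℝ := fun u => a Complex.I Complex.I u - a 1 Complex.I u ^ 2 / A u
  have hd : ContDiff ℝ ∞ d := (ha _ _).sub (((ha _ _).pow 2).div hA fun u => (hApos u).ne')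
  have hd0 : 0 < d 0 := by
    have hne : A 0 ≠ 0 := (hApos 0).ne'
    have hAeq : A 0 = a 1 1 0 := hAa.eq_of_nhds
    have h1 := hpos (Complex.I - ((a 1 Complex.I 0 / A 0 : ℝ) : ℂ)) (fun h => by
      have := congrArg Complex.im h
      simp at this)
    rw [show ((a 1 Complex.I 0 / A 0 : ℝ) : ℂ) = (a 1 Complex.I 0 / A 0) • (1 : ℂ) by simp] at h1
    simp only [map_sub, map_smul, sub_apply, smul_apply, smul_eq_mul] at h1
    have e1 := ha0 1 1
    have e2 := ha0 1 Complex.I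
    have e3 := ha0 Complex.I 1
    have e4 := ha0 Complex.I Complex.I
    rw [hsymm Complex.I 1] at e3
    rw [show fderiv ℝ (fderiv ℝ h) 0 1 1 = 2 * A 0 by rw [hAeq, e1]; ring,
      show fderiv ℝ (fderiv ℝ h) 0 1 Complex.I = 2 * a 1 Complex.I 0 by rw [e2]; ring,
      show fderiv ℝ (fderiv ℝ h) 0 Complex.I 1 = 2 * a 1 Complex.I 0 by rw [e3]; ring,
      show fderiv ℝ (fderiv ℝ h) 0 Complex.I Complex.I = 2 * a Complex.I Complex.I 0 by
        rw [e4]; ring] at h1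
    have h2 : a 1 Complex.I 0 / A 0 * (2 * A 0) = 2 * a 1 Complex.I 0 := by field_simp
    rw [h2] at h1
    have h3 : d 0 = a Complex.I Complex.I 0 - a 1 Complex.I 0 / A 0 * a 1 Complex.I 0 := by
      simp only [d]; ring
    rw [h3]
    nlinarith
  obtain ⟨δ, hδ, hδd, hδpos⟩ := exists_contDiff_pos_eventuallyEq hd hd0
  let m : ℂ → ℂ := fun u => ((√(A u) * (u.re + a 1 Complex.I u / A u * u.im) : ℝ) : ℂ) +
    ((√(δ u) * u.im : ℝ) : ℂ) * Complex.I
  have hsA : ContDiff ℝ ∞ fun u => √(A u) := hA.sqrt fun u => (hApos u).ne'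
  have hsδ : ContDiff ℝ ∞ fun u => √(δ u) := hδ.sqrt fun u => (hδpos u).ne'
  have hq : ContDiff ℝ ∞ fun u => a 1 Complex.I u / A u := (ha _ _).div hA fun u => (hApos u).ne'
  have hre : ContDiff ℝ ∞ Complex.re := Complex.reCLM.contDiff
  have him : ContDiff ℝ ∞ Complex.im := Complex.imCLM.contDiff
  have hm : ContDiff ℝ ∞ m :=
    (Complex.ofRealCLM.contDiff.comp (hsA.mul (hre.add (hq.mul him)))).add
      ((Complex.ofRealCLM.contDiff.comp (hsδ.mul him)).mul contDiff_const)
  have hm0 : m 0 = 0 := by simp [m]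
  have hDm : ∀ v : ℂ, fderiv ℝ m 0 v = ((√(A 0) * (v.re + a 1 Complex.I 0 / A 0 * v.im) : ℝ) : ℂ) +
      ((√(δ 0) * v.im : ℝ) : ℂ) * Complex.I := by
    intro v
    have hl : HasDerivAt (fun s : ℝ => s • v) v 0 := by
      simpa using (hasDerivAt_id (0 : ℝ)).smul_const v
    have h1 : HasDerivAt (fun s : ℝ => m (s • v)) (fderiv ℝ m 0 v) 0 := by
      have h2 : HasFDerivAt m (fderiv ℝ m 0) ((0 : ℝ) • v) := by
        rw [zero_smul]
        exact (hm.differentiable (by simp) 0).hasFDerivAt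
      exact h2.comp_hasDerivAt 0 hl
    let k : ℝ → ℂ := fun s =>
      ((√(A (s • v)) * (v.re + a 1 Complex.I (s • v) / A (s • v) * v.im) : ℝ) : ℂ) +
      ((√(δ (s • v)) * v.im : ℝ) : ℂ) * Complex.I
    have hk : ContDiff ℝ ∞ k := by
      have hl : ContDiff ℝ ∞ fun s : ℝ => s • v := by fun_prop
      exact (Complex.ofRealCLM.contDiff.comp ((hsA.comp hl).mul (contDiff_const.add
        ((hq.comp hl).mul contDiff_const)))).add
        ((Complex.ofRealCLM.contDiff.comp ((hsδ.comp hl).mul contDiff_const)).mul contDiff_const)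
    have h3 : HasDerivAt (fun s : ℝ => s • k s) (k 0) 0 := by
      convert! (hasDerivAt_id (0 : ℝ)).smul (hk.differentiable (by simp) 0).hasDerivAt using 1
      simp
    have h4 : (fun s : ℝ => m (s • v)) = fun s => s • k s := by
      funext s
      apply Complex.ext <;> simp [m, k] <;> ring
    rw [h4] at h1
    rw [h1.unique h3]
    simp [k]
  refine ⟨m, hm, hm0, ?_, ?_⟩
  · rw [hDm, hDm]
    have h1 := Real.sqrt_pos.2 (hApos 0)
    have h2 := Real.sqrt_pos.2 (hδpos 0)
    simp [planeDet]
    positivity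
  · filter_upwards [hAa, hδd] with u hu1 hu2
    rw [hrep u, Complex.sq_norm, Complex.normSq_apply]
    have h1 := Real.mul_self_sqrt (hApos u).le
    have h2 := Real.mul_self_sqrt (hδpos u).le
    have hne := (hApos u).ne'
    have e1 : (m u).re = √(A u) * (u.re + a 1 Complex.I u / A u * u.im) := by simp [m]
    have e2 : (m u).im = √(δ u) * u.im := by simp [m]
    rw [e1, e2, ← hu1]
    have h3 : √(A u) * (u.re + a 1 Complex.I u / A u * u.im) *
        (√(A u) * (u.re + a 1 Complex.I u / A u * u.im)) =
        A u * (u.re + a 1 Complex.I u / A u * u.im) ^ 2 := by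
      rw [← h1]; ring_nf; simp only [Real.sqrt_sq (Real.sqrt_nonneg _)]
    have h4 : √(δ u) * u.im * (√(δ u) * u.im) = d u * u.im ^ 2 := by
      rw [← hu2, ← h2]; ring_nf; simp only [Real.sqrt_sq (Real.sqrt_nonneg _)]
    rw [h3, h4]
    simp only [d]
    field_simp
    ring

end PlaneMorse

noncomputable section AreaNormalization
open Set Filter Topology
open scoped ContDiff Real

/-- The rotation factor `exp (i t)`. -/
def rotFactor (t : ℝ) : ℂ := Complex.exp (t * Complex.I)

theorem contDiff_rotFactor : ContDiff ℝ ∞ rotFactor :=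
  Complex.contDiff_exp.comp (Complex.ofRealCLM.contDiff.mul contDiff_const)

theorem rotFactor_add (s t : ℝ) : rotFactor (s + t) = rotFactor s * rotFactor t := by
  simp [rotFactor, add_mul, Complex.exp_add]

@[simp] theorem rotFactor_zero : rotFactor 0 = 1 := by simp [rotFactor]

@[simp] theorem rotFactor_two_pi : rotFactor (2 * π) = 1 := by
  simp [rotFactor, Complex.exp_two_pi_mul_I]

@[simp] theorem norm_rotFactor (t : ℝ) : ‖rotFactor t‖ = 1 := Complex.norm_exp_ofReal_mul_I t

theorem hasDerivAt_rotFactor (t : ℝ) : HasDerivAt rotFactor (rotFactor t * Complex.I) t := by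
  have h1 : HasDerivAt (fun t : ℝ => (t : ℂ) * Complex.I) Complex.I t := by
    simpa using (Complex.ofRealCLM.hasDerivAt (x := t)).mul_const Complex.I
  exact h1.cexp

theorem eq_rotFactor_arg_mul (z : ℂ) : z = rotFactor z.arg * (‖z‖ : ℂ) := by
  rw [mul_comm]
  exact (Complex.norm_mul_exp_arg_mul_I z).symm

theorem intervalIntegral_rotFactor (f : ℂ → ℝ) (s : ℝ) (z : ℂ) :
    ∫ t in s..s + 2 * π, f (rotFactor t * z) = ∫ t in (0 : ℝ)..2 * π, f (rotFactor t * z) := by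
  have hp : Function.Periodic (fun t => f (rotFactor t * z)) (2 * π) := fun t => by
    simp [rotFactor_add]
  simpa using hp.intervalIntegral_add_eq s 0

theorem intervalIntegral_rotFactor_mul (f : ℂ → ℝ) (s : ℝ) (z : ℂ) :
    ∫ t in (0 : ℝ)..2 * π, f (rotFactor t * (rotFactor s * z)) =
      ∫ t in (0 : ℝ)..2 * π, f (rotFactor t * z) := by
  rw [← intervalIntegral_rotFactor f s z]
  have := intervalIntegral.integral_comp_add_right (a := 0) (b := 2 * π)
    (fun t => f (rotFactor t * z)) s
  rw [zero_add, add_comm (2 * π) s] at this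
  rw [← this]
  simp only [rotFactor_add, mul_assoc]

/-- Solving `∂_θ α = g` for functions with zero mean on circles. -/
theorem exists_angular_primitive {g : ℂ → ℝ} (hg : ContDiff ℝ ∞ g)
    (hmean : ∀ z, ∫ t in (0 : ℝ)..2 * π, g (rotFactor t * z) = 0) :
    ∃ α : ℂ → ℝ, ContDiff ℝ ∞ α ∧
      ∀ z, HasDerivAt (fun s => α (rotFactor s * z)) (g z) 0 := by
  have hrot := contDiff_rotFactor
  have hrotc := contDiff_rotFactor.continuous
  have hgc := hg.continuous
  refine ⟨fun z => (2 * π)⁻¹ * ∫ t in (0 : ℝ)..2 * π, t * g (rotFactor t * z),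
    contDiff_const.mul (contDiff_intervalIntegral_of_contDiff
      (f := fun q : ℂ × ℝ => q.2 * g (rotFactor q.2 * q.1)) (contDiff_snd.mul
        (hg.comp ((hrot.comp contDiff_snd).mul contDiff_fst))) (by positivity)), fun z => ?_⟩
  let γ : ℝ → ℝ := fun t => g (rotFactor t * z)
  have hγ : Continuous γ := by fun_prop
  let Γ : ℝ → ℝ := fun s => ∫ t in (0 : ℝ)..s, t * γ t
  have hΓ : ∀ s, HasDerivAt Γ (s * γ s) s := fun s =>
    intervalIntegral.integral_hasDerivAt_right
      ((by fun_prop : Continuous fun t => t * γ t).intervalIntegrable _ _)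
      ((by fun_prop : Continuous fun t => t * γ t).stronglyMeasurableAtFilter _ _)
      (by fun_prop : Continuous fun t => t * γ t).continuousAt
  have hint : ∀ a b : ℝ, IntervalIntegrable (fun t => t * γ t) MeasureTheory.volume a b :=
    fun a b => (by fun_prop : Continuous fun t => t * γ t).intervalIntegrable a b
  have hform : ∀ s, ∫ t in (0 : ℝ)..2 * π, t * g (rotFactor t * (rotFactor s * z)) =
      Γ (s + 2 * π) - Γ s := by
    intro s
    have h1 := intervalIntegral.integral_comp_add_right (a := 0) (b := 2 * π)
      (fun t => (t - s) * γ t) s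
    have h2 : ∫ t in s..s + 2 * π, (t - s) * γ t = Γ (s + 2 * π) - Γ s := by
      simp only [sub_mul]
      rw [intervalIntegral.integral_sub (hint _ _)
        ((by fun_prop : Continuous fun t => s * γ t).intervalIntegrable _ _),
        intervalIntegral.integral_const_mul, intervalIntegral_rotFactor g s z, hmean, mul_zero,
        sub_zero, intervalIntegral.integral_interval_sub_left (hint _ _) (hint _ _)]
    rw [zero_add, add_comm (2 * π) s, h2] at h1
    rw [← h1]
    simp [γ, rotFactor_add, mul_assoc]
  simp only [hform]
  have h1 : HasDerivAt (fun s => Γ (s + 2 * π)) ((0 + 2 * π) * γ (0 + 2 * π)) 0 :=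
    (hΓ (0 + 2 * π)).comp_add_const 0 (2 * π)
  convert! (h1.sub (hΓ 0)).const_mul (2 * π)⁻¹ using 1
  have : π ≠ 0 := Real.pi_ne_zero
  simp [γ]
  field_simp

/-- Every positive smooth density on the plane is the Jacobian of a smooth map
sending circles around the origin to such circles. -/
theorem exists_area_normalization {ρ : ℂ → ℝ} (hρ : ContDiff ℝ ∞ ρ) (hpos : ∀ z, 0 < ρ z) :
    ∃ Θ : ℂ → ℂ, ContDiff ℝ ∞ Θ ∧ Θ 0 = 0 ∧
      (∀ z, planeDet (fderiv ℝ Θ z 1) (fderiv ℝ Θ z Complex.I) = ρ z) ∧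
      ∀ z w, ‖Θ z‖ = ‖Θ w‖ ↔ ‖z‖ = ‖w‖ := by
  have hrot := contDiff_rotFactor
  have hrotc := contDiff_rotFactor.continuous
  have hρc := hρ.continuous
  let A : ℂ → ℝ := fun z => (2 * π)⁻¹ * ∫ t in (0 : ℝ)..2 * π, ρ (rotFactor t * z)
  have hA : ContDiff ℝ ∞ A := contDiff_const.mul (contDiff_intervalIntegral_of_contDiff
    (f := fun q : ℂ × ℝ => ρ (rotFactor q.2 * q.1))
    (hρ.comp ((hrot.comp contDiff_snd).mul contDiff_fst)) (by positivity))
  have hAc := hA.continuous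
  have hApos : ∀ z, 0 < A z := fun z => by
    have : 0 < ∫ t in (0 : ℝ)..2 * π, ρ (rotFactor t * z) :=
      intervalIntegral.intervalIntegral_pos_of_pos
        ((by fun_prop : Continuous _).intervalIntegrable _ _) (fun t => hpos _) (by positivity)
    simp only [A]
    positivity
  have hArot : ∀ s z, A (rotFactor s * z) = A z := fun s z => by
    simp only [A, intervalIntegral_rotFactor_mul ρ]
  let g : ℂ → ℝ := fun z => ρ z / A z - 1
  have hg : ContDiff ℝ ∞ g := (hρ.div hA fun z => (hApos z).ne').sub contDiff_const
  have hgmean : ∀ z, ∫ t in (0 : ℝ)..2 * π, g (rotFactor t * z) = 0 := by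
    intro z
    simp only [g, hArot]
    rw [intervalIntegral.integral_sub
      ((by fun_prop : Continuous fun t => ρ (rotFactor t * z) / A z).intervalIntegrable _ _)
      (by simp), intervalIntegral.integral_div]
    have h1 : ∫ t in (0 : ℝ)..2 * π, ρ (rotFactor t * z) = 2 * π * A z := by
      simp only [A]
      rw [← mul_assoc, mul_inv_cancel₀ (by positivity), one_mul]
    rw [h1, mul_div_assoc, div_self (hApos z).ne']
    simp
  obtain ⟨α, hα, hαd⟩ := exists_angular_primitive hg hgmean
  clear_value A
  let b : ℂ → ℝ := fun z => ∫ u in (0 : ℝ)..1, A (u * z) * (2 * u)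
  have hb : ContDiff ℝ ∞ b := contDiff_intervalIntegral_of_contDiff
    (f := fun q : ℂ × ℝ => A (q.2 * q.1) * (2 * q.2)) ((hA.comp ((Complex.ofRealCLM.contDiff.comp
      contDiff_snd).mul contDiff_fst)).mul (contDiff_const.mul contDiff_snd)) zero_le_one
  have hbpos : ∀ z, 0 < b z := fun z => by
    refine intervalIntegral.intervalIntegral_pos_of_pos_on
      ((by fun_prop : Continuous _).intervalIntegrable _ _) (fun u hu => ?_) zero_lt_one
    have := hApos (u * z)
    have := hu.1
    positivity
  have hbrot : ∀ s z, b (rotFactor s * z) = b z := fun s z => by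
    simp only [b, mul_left_comm _ (rotFactor s), hArot]
  let Θ : ℂ → ℂ := fun z => (√(b z) : ℂ) * (rotFactor (α z) * z)
  have hΘ : ContDiff ℝ ∞ Θ := (Complex.ofRealCLM.contDiff.comp
    (hb.sqrt fun z => (hbpos z).ne')).mul ((hrot.comp hα).mul contDiff_id)
  have hΘd : ∀ z, HasFDerivAt Θ (fderiv ℝ Θ z) z := fun z =>
    (hΘ.differentiable (by simp) z).hasFDerivAt
  have hΘn : ∀ z, ‖Θ z‖ ^ 2 = b z * ‖z‖ ^ 2 := fun z => by
    simp only [Θ, norm_mul, norm_rotFactor, one_mul, mul_pow, Complex.norm_real, Real.norm_eq_abs,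
      sq_abs, Real.sq_sqrt (hbpos z).le]
  let N : ℂ → ℝ → ℝ := fun z l => ∫ s in (0 : ℝ)..l, A (s * z) * (2 * s)
  have hN : ∀ z (l : ℝ), HasDerivAt (N z) (A ((l : ℂ) * z) * (2 * l)) l := fun z l =>
    have hc : Continuous fun s : ℝ => A (s * z) * (2 * s) := by fun_prop
    intervalIntegral.integral_hasDerivAt_right (hc.intervalIntegrable _ _)
      (hc.stronglyMeasurableAtFilter _ _) hc.continuousAt
  have hΘN : ∀ (l : ℝ) z, ‖Θ (l * z)‖ ^ 2 = ‖z‖ ^ 2 * N z l := by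
    intro l z
    have h1 := intervalIntegral.mul_integral_comp_mul_right (a := 0) (b := 1)
      (f := fun s : ℝ => A (s * z) * (2 * s)) l
    rw [zero_mul, one_mul] at h1
    rw [hΘn]
    simp only [N]
    rw [← h1, norm_mul, mul_pow, Complex.norm_real, Real.norm_eq_abs, sq_abs]
    have h2 : ∫ x in (0 : ℝ)..1, A (((x * l : ℝ) : ℂ) * z) * (2 * (x * l)) = b (l * z) * l := by
      simp only [b]
      rw [← intervalIntegral.integral_mul_const]
      refine intervalIntegral.integral_congr fun x _ => ?_
      rw [Complex.ofReal_mul, mul_assoc (x : ℂ)]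
      ring
    rw [h2]
    ring
  have hjac1 : ∀ z, z ≠ 0 → planeDet (fderiv ℝ Θ z 1) (fderiv ℝ Θ z Complex.I) = ρ z := by
    intro z hz
    have hrad : HasDerivAt (fun l : ℝ => Θ (l * z)) (fderiv ℝ Θ z z) 1 := by
      have h1 : HasDerivAt (fun l : ℝ => (l : ℂ) * z) z 1 := by
        simpa using (Complex.ofRealCLM.hasDerivAt (x := (1 : ℝ))).mul_const z
      have h2 : HasFDerivAt Θ (fderiv ℝ Θ z) (((1 : ℝ) : ℂ) * z) := by simpa using hΘd z
      exact h2.comp_hasDerivAt 1 h1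
    have hang : HasDerivAt (fun s : ℝ => Θ (rotFactor s * z)) (fderiv ℝ Θ z (Complex.I * z)) 0 := by
      have h1 : HasDerivAt (fun s => rotFactor s * z) (Complex.I * z) 0 := by
        simpa using (hasDerivAt_rotFactor 0).mul_const z
      have h2 : HasFDerivAt Θ (fderiv ℝ Θ z) (rotFactor 0 * z) := by simpa using hΘd z
      exact h2.comp_hasDerivAt 0 h1
    have hang' : HasDerivAt (fun s : ℝ => Θ (rotFactor s * z))
        (((ρ z / A z : ℝ) : ℂ) * Complex.I * Θ z) 0 := by
      have h1 : HasDerivAt (fun s : ℝ => rotFactor (α (rotFactor s * z)))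
          (g z • (rotFactor (α (rotFactor 0 * z)) * Complex.I)) 0 :=
        HasDerivAt.scomp (0 : ℝ) (hasDerivAt_rotFactor _) (hαd z)
      have h2 := (h1.mul ((hasDerivAt_rotFactor 0).mul_const z)).const_mul (√(b z) : ℂ)
      convert! h2 using 1
      · funext s
        simp [Θ, hbrot]
      · simp [Θ, g]
        ring
    have h1 := hang.unique hang'
    have h2 : HasDerivAt (fun l : ℝ => ‖Θ (l * z)‖ ^ 2) (‖z‖ ^ 2 * (A z * 2)) 1 := by
      simp only [hΘN]
      simpa using (hN z 1).const_mul (‖z‖ ^ 2)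
    have h3 := hrad.norm_sq.unique h2
    simp only [Complex.ofReal_one, one_mul] at h3
    rw [Complex.inner] at h3
    have h4 := planeDet_apply (fderiv ℝ Θ z) z (Complex.I * z)
    rw [h1] at h4
    have h5 : planeDet z (Complex.I * z) = ‖z‖ ^ 2 := by
      rw [Complex.sq_norm, Complex.normSq_apply]; simp [planeDet]
    have h6 : planeDet (fderiv ℝ Θ z z) (((ρ z / A z : ℝ) : ℂ) * Complex.I * Θ z) =
        ρ z / A z * (‖z‖ ^ 2 * A z) := by
      have : (fderiv ℝ Θ z z).re * (Θ z).re + (fderiv ℝ Θ z z).im * (Θ z).im = ‖z‖ ^ 2 * A z := by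
        simp at h3
        linarith
      rw [← this]
      generalize ρ z / A z = r
      simp [planeDet]
      ring
    rw [h5, h6] at h4
    have h7 : ‖z‖ ^ 2 ≠ 0 := by positivity
    have h8 := (hApos z).ne'
    field_simp at h4
    exact h4.symm
  refine ⟨Θ, hΘ, by simp [Θ], fun z => ?_, fun z w => ?_⟩
  · have hc : Continuous fun z => planeDet (fderiv ℝ Θ z 1) (fderiv ℝ Θ z Complex.I) := by
      have := hΘ.continuous_fderiv (by simp)
      unfold planeDet
      fun_prop
    have hd : Dense ({0}ᶜ : Set ℂ) := dense_compl_singleton 0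
    exact congrFun (hc.ext_on hd hρc fun z hz => hjac1 z hz) z
  · have hmono : StrictMonoOn (N 1) (Ici 0) := by
      refine strictMonoOn_of_deriv_pos (convex_Ici 0)
        (fun l _ => (hN 1 l).continuousAt.continuousWithinAt) fun l hl => ?_
      rw [interior_Ici] at hl
      rw [(hN 1 l).deriv]
      have h1 := hApos (l * 1)
      have h2 : 0 < l := hl
      positivity
    have hred : ∀ z, ‖Θ z‖ ^ 2 = N 1 ‖z‖ := by
      intro z
      have h1 : ‖Θ z‖ ^ 2 = ‖Θ (‖z‖ : ℂ)‖ ^ 2 := by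
        rw [hΘn, hΘn]
        have h2 : b z = b (‖z‖ : ℂ) := by
          rw [← hbrot z.arg (‖z‖ : ℂ), ← eq_rotFactor_arg_mul]
        rw [h2]
        simp
      rw [h1, ← mul_one (‖z‖ : ℂ), hΘN]
      simp
    have h1 : ‖Θ z‖ = ‖Θ w‖ ↔ ‖Θ z‖ ^ 2 = ‖Θ w‖ ^ 2 :=
      (pow_left_inj₀ (norm_nonneg _) (norm_nonneg _) two_ne_zero).symm
    rw [h1, hred, hred]
    exact hmono.injOn.eq_iff (norm_nonneg _) (norm_nonneg _)

end AreaNormalization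

noncomputable section PlanarNormalForm
open Set Filter Topology
open scoped ContDiff Real

/-- The Jacobian determinant of a map of the plane. -/
def planeJac (f : ℂ → ℂ) (z : ℂ) : ℝ := planeDet (fderiv ℝ f z 1) (fderiv ℝ f z Complex.I)

theorem planeJac_comp {f g : ℂ → ℂ} {z : ℂ} (hf : DifferentiableAt ℝ f (g z))
    (hg : DifferentiableAt ℝ g z) :
    planeJac (fun z => f (g z)) z = planeJac f (g z) * planeJac g z := by
  simp only [planeJac]
  rw [fderiv_fun_comp z hf hg]
  exact planeDet_apply (fderiv ℝ f (g z)) (fderiv ℝ g z 1) (fderiv ℝ g z Complex.I)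

theorem planeJac_eq_one_of_eventuallyEq {f : ℂ → ℂ} {z : ℂ} (hf : ∀ᶠ w in 𝓝 z, f w = w) :
    planeJac f z = 1 := by
  have h : fderiv ℝ f z = fderiv ℝ id z := Filter.EventuallyEq.fderiv_eq hf
  simp [planeJac, h, planeDet]

theorem contDiff_planeJac {f : ℂ → ℂ} (hf : ContDiff ℝ ∞ f) : ContDiff ℝ ∞ (planeJac f) := by
  have h : ContDiff ℝ ∞ (fderiv ℝ f) := hf.fderiv_right (by simp)
  have h1 : ∀ v, ContDiff ℝ ∞ fun z => fderiv ℝ f z v := fun v => h.clm_apply contDiff_const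
  have hre : ContDiff ℝ ∞ Complex.re := Complex.reCLM.contDiff
  have him : ContDiff ℝ ∞ Complex.im := Complex.imCLM.contDiff
  unfold planeJac planeDet
  exact ((hre.comp (h1 _)).mul (him.comp (h1 _))).sub ((him.comp (h1 _)).mul (hre.comp (h1 _)))

/-- A function on the plane with a nondegenerate minimum becomes radial, and a positive density
becomes constant, in suitable coordinates. -/
theorem exists_planar_normal_form {h ρ : ℂ → ℝ} (hh : ContDiff ℝ ∞ h) (h0 : fderiv ℝ h 0 = 0)
    (hpos : ∀ u : ℂ, u ≠ 0 → 0 < fderiv ℝ (fderiv ℝ h) 0 u u) (hρ : ContDiff ℝ ∞ ρ)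
    (hρ0 : 0 < ρ 0) :
    ∃ (κ : ℂ → ℂ) (P : ℝ → ℝ) (r : ℝ), ContDiff ℝ ∞ κ ∧ ContDiff ℝ ∞ P ∧ 0 < r ∧ κ 0 = 0 ∧
      (∀ w, ‖w‖ < r → ρ (κ w) * planeJac κ w = 1) ∧
      (∀ w, ‖w‖ < r → h (κ w) = P (‖w‖ ^ 2 / 2)) ∧
      ∀ w w', ‖w‖ < r → ‖w'‖ < r → (h (κ w) = h (κ w') ↔ ‖w‖ = ‖w'‖) := by
  have hdiff : ∀ {f : ℂ → ℂ}, ContDiff ℝ ∞ f → ∀ z, DifferentiableAt ℝ f z :=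
    fun hf z => hf.differentiable (by simp) z
  obtain ⟨m, hm, hm0, hmj, hmh⟩ := exists_morse_chart hh h0 hpos
  obtain ⟨g, hg, hg0, hmg, -⟩ := exists_contDiff_localInverse hm
    (isInvertible_of_planeDet_ne_zero hmj.ne')
  rw [hm0] at hg0 hmg
  have hgj : planeJac m 0 * planeJac g 0 = 1 := by
    have := planeJac_comp (hdiff hm (g 0)) (hdiff hg 0)
    rw [planeJac_eq_one_of_eventuallyEq hmg, hg0] at this
    exact this.symm
  have hgj0 : 0 < planeJac g 0 := by
    have : 0 < planeJac m 0 * planeJac g 0 := by rw [hgj]; exact one_pos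
    exact (pos_iff_pos_of_mul_pos this).1 hmj
  obtain ⟨ρ₂, hρ₂, hρeq, hρ₂pos⟩ := exists_contDiff_pos_eventuallyEq (a := (0 : ℂ))
    ((hρ.comp hg).mul (contDiff_planeJac hg)) (by simp only [Function.comp, hg0]; positivity)
  obtain ⟨Θ, hΘ, hΘ0, hΘj, hΘn⟩ := exists_area_normalization hρ₂ hρ₂pos
  obtain ⟨χ, hχ, hχ0, hΘχ, -⟩ := exists_contDiff_localInverse (a := (0 : ℂ)) hΘ
    (isInvertible_of_planeDet_ne_zero (by rw [hΘj]; exact (hρ₂pos 0).ne'))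
  rw [hΘ0] at hχ0 hΘχ
  have hχt : Tendsto χ (𝓝 0) (𝓝 0) := by simpa [hχ0] using hχ.continuous.tendsto 0
  have hκ : ContDiff ℝ ∞ fun w => g (χ w) := hg.comp hχ
  have hκt : Tendsto (fun w => g (χ w)) (𝓝 0) (𝓝 0) := by
    simpa [hχ0, hg0] using hκ.continuous.tendsto 0
  have hev1 : ∀ᶠ w in 𝓝 0, ρ (g (χ w)) * planeJac (fun w => g (χ w)) w = 1 := by
    filter_upwards [hχt.eventually hρeq, hΘχ.eventually_nhds] with w h1 h2
    rw [planeJac_comp (hdiff hg _) (hdiff hχ _), ← mul_assoc]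
    simp only [Function.comp] at h1
    rw [← h1, ← hΘj, ← planeJac_eq_one_of_eventuallyEq h2, planeJac_comp (hdiff hΘ _) (hdiff hχ _)]
    rfl
  have hev2 : ∀ᶠ w in 𝓝 0, h (g (χ w)) = h 0 + ‖χ w‖ ^ 2 := by
    filter_upwards [hκt.eventually hmh, hχt.eventually hmg] with w h1 h2
    rw [h1, h2]
  obtain ⟨r, hr, hball⟩ := Metric.eventually_nhds_iff.1 (hev1.and (hev2.and hΘχ))
  simp only [dist_zero_right] at hball
  have hiff : ∀ w w', ‖w‖ < r → ‖w'‖ < r → (h (g (χ w)) = h (g (χ w')) ↔ ‖w‖ = ‖w'‖) := by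
    intro w w' hw hw'
    obtain ⟨-, h1, h2⟩ := hball hw
    obtain ⟨-, h1', h2'⟩ := hball hw'
    rw [h1, h1', add_right_inj, pow_left_inj₀ (norm_nonneg _) (norm_nonneg _) two_ne_zero,
      ← hΘn, h2, h2']
  obtain ⟨q, hq, hqe⟩ := exists_contDiff_comp_sq (f := fun x : ℝ => h (g (χ (x : ℂ))))
    (hh.comp (hκ.comp Complex.ofRealCLM.contDiff)) (by
      filter_upwards [Metric.ball_mem_nhds (0 : ℝ) hr] with x hx
      rw [mem_ball_zero_iff] at hx
      exact (hiff _ _ (by simpa using hx) (by simpa using hx)).2 (by simp))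
  obtain ⟨r', hr', hball'⟩ := Metric.eventually_nhds_iff.1 hqe
  simp only [dist_zero_right] at hball'
  refine ⟨fun w => g (χ w), fun s => q (2 * s), min r r', hκ,
    hq.comp (contDiff_const.mul contDiff_id),
    lt_min hr hr', by simp [hχ0, hg0], fun w hw => (hball (hw.trans_le (min_le_left _ _))).1,
    fun w hw => ?_, fun w w' hw hw' => hiff w w' (hw.trans_le (min_le_left _ _))
      (hw'.trans_le (min_le_left _ _))⟩
  have h1 := hball' (y := ‖w‖) (by simpa using hw.trans_le (min_le_right _ _))
  have h2 : ‖w‖ < r := hw.trans_le (min_le_left _ _)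
  show h (g (χ w)) = q (2 * (‖w‖ ^ 2 / 2))
  rw [mul_div_cancel₀ _ two_ne_zero, ← h1]
  exact (hiff _ _ h2 (by simpa using h2)).2 (by simp)

end PlanarNormalForm

noncomputable section TripleProduct
open Set Filter Topology RealInnerProductSpace
open scoped ContDiff Real

/-- The scalar triple product. -/
def triple (a b c : R3) : ℝ :=
  a 0 * (b 1 * c 2 - b 2 * c 1) - a 1 * (b 0 * c 2 - b 2 * c 0) + a 2 * (b 0 * c 1 - b 1 * c 0)

theorem triple_eq_det (a b c : R3) :
    triple a b c = (EuclideanSpace.basisFun (Fin 3) ℝ).toBasis.det ![a, b, c] := by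
  rw [Module.Basis.det_apply, Matrix.det_fin_three]
  simp [Module.Basis.toMatrix_apply, triple]
  ring

theorem det_mul_triple (L : R3 →ₗ[ℝ] R3) (a b c : R3) :
    LinearMap.det L * triple a b c = triple (L a) (L b) (L c) := by
  rw [triple_eq_det, triple_eq_det, ← Module.Basis.det_comp]
  congr 1
  funext i
  fin_cases i <;> rfl

theorem R3_eq_sum (v : R3) : v = v 0 • e3 0 + v 1 • e3 1 + v 2 • e3 2 := by
  ext i
  fin_cases i <;> simp [e3]

theorem trace_mul_triple (L : R3 →ₗ[ℝ] R3) (a b c : R3) :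
    LinearMap.trace ℝ R3 L * triple a b c =
      triple (L a) b c + triple a (L b) c + triple a b (L c) := by
  have h : ∀ v, L v = v 0 • L (e3 0) + v 1 • L (e3 1) + v 2 • L (e3 2) := fun v => by
    conv_lhs => rw [R3_eq_sum v]
    simp
  have ht : LinearMap.trace ℝ R3 L = L (e3 0) 0 + L (e3 1) 1 + L (e3 2) 2 := by
    rw [LinearMap.trace_eq_matrix_trace ℝ (EuclideanSpace.basisFun (Fin 3) ℝ).toBasis,
      Matrix.trace_fin_three]
    simp [LinearMap.toMatrix_apply, e3]
  rw [ht, h a, h b, h c]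
  simp [triple]
  ring

theorem hasDerivAt_triple {a b c : ℝ → R3} {a' b' c' : R3} {t : ℝ} (ha : HasDerivAt a a' t)
    (hb : HasDerivAt b b' t) (hc : HasDerivAt c c' t) :
    HasDerivAt (fun t => triple (a t) (b t) (c t))
      (triple a' (b t) (c t) + triple (a t) b' (c t) + triple (a t) (b t) c') t := by
  have hco : ∀ {a : ℝ → R3} {a' : R3}, HasDerivAt a a' t → ∀ i,
      HasDerivAt (fun t => a t i) (a' i) t := fun h i =>
    ((EuclideanSpace.proj (𝕜 := ℝ) i : R3 →L[ℝ] ℝ).hasFDerivAt (x := _)).comp_hasDerivAt t h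
  have a0 := hco ha
  have b0 := hco hb
  have c0 := hco hc
  unfold triple
  convert! (((a0 0).mul (((b0 1).mul (c0 2)).sub ((b0 2).mul (c0 1)))).sub
    ((a0 1).mul (((b0 0).mul (c0 2)).sub ((b0 2).mul (c0 0))))).add
    ((a0 2).mul (((b0 0).mul (c0 1)).sub ((b0 1).mul (c0 0)))) using 1
  simp
  ring

/-- The determinant of three vectors of `ℂ × ℝ`. -/
def spaceDet (u v w : ℂ × ℝ) : ℝ :=
  planeDet u.1 v.1 * w.2 - planeDet u.1 w.1 * v.2 + planeDet v.1 w.1 * u.2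

theorem triple_apply (A : ℂ × ℝ →L[ℝ] R3) (u v w : ℂ × ℝ) :
    triple (A u) (A v) (A w) =
      triple (A (1, 0)) (A (Complex.I, 0)) (A (0, 1)) * spaceDet u v w := by
  have h : ∀ u : ℂ × ℝ, A u = u.1.re • A (1, 0) + u.1.im • A (Complex.I, 0) + u.2 • A (0, 1) := by
    intro u
    rw [← map_smul, ← map_smul, ← map_smul, ← map_add, ← map_add]
    congr 1
    refine Prod.ext (Complex.ext ?_ ?_) ?_ <;> simp
  rw [h u, h v, h w]
  simp [triple, spaceDet, planeDet]
  ring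

/-- The Jacobian determinant of a map from `ℂ × ℝ` to space. -/
def spaceJac (Q : ℂ × ℝ → R3) (q : ℂ × ℝ) : ℝ :=
  triple (fderiv ℝ Q q (1, 0)) (fderiv ℝ Q q (Complex.I, 0)) (fderiv ℝ Q q (0, 1))

theorem isInvertible_of_triple_ne_zero {A : ℂ × ℝ →L[ℝ] R3}
    (hA : triple (A (1, 0)) (A (Complex.I, 0)) (A (0, 1)) ≠ 0) : A.IsInvertible := by
  refine isInvertible_of_injective (by simp) ((injective_iff_map_eq_zero A).2 fun u hu => ?_)
  have h0 : ∀ v w, spaceDet u v w = 0 := fun v w => by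
    have := triple_apply A u v w
    rw [hu] at this
    exact (mul_eq_zero.1 (this.symm.trans (by simp [triple]))).resolve_left hA
  have h1 := h0 (Complex.I, 0) (0, 1)
  have h2 := h0 (1, 0) (0, 1)
  have h3 := h0 (1, 0) (Complex.I, 0)
  simp [spaceDet, planeDet] at h1 h2 h3
  exact Prod.ext (Complex.ext h1 h2) h3

theorem exists_orthogonal_frame {b : R3} (hb : b ≠ 0) :
    ∃ e e' : R3, ⟪e, b⟫ = 0 ∧ ⟪e', b⟫ = 0 ∧ 0 < triple e e' b := by
  have hin : ∀ u v : R3, ⟪u, v⟫ = u 0 * v 0 + u 1 * v 1 + u 2 * v 2 := fun u v => by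
    simp [PiLp.inner_apply, Fin.sum_univ_three]
    ring
  have key : ∀ e : R3, ⟪e, b⟫ = 0 → e ≠ 0 → ∃ e e' : R3, ⟪e, b⟫ = 0 ∧ ⟪e', b⟫ = 0 ∧
      0 < triple e e' b := by
    intro e he he0
    refine ⟨e, cross3 b e, he, by simp [hin, cross3, pt]; ring, ?_⟩
    have h1 : triple e (cross3 b e) b = ⟪e, e⟫ * ⟪b, b⟫ - ⟪e, b⟫ ^ 2 := by
      simp only [hin]; simp [cross3, pt, triple]; ring
    rw [h1, he]
    have h2 := real_inner_self_pos.2 he0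
    have h3 := real_inner_self_pos.2 hb
    simp only [ne_eq, OfNat.ofNat_ne_zero, not_false_eq_true, zero_pow, sub_zero]
    exact mul_pos h2 h3
  by_cases h : b 1 = 0 ∧ b 2 = 0
  · refine key (pt 0 1 0) (by simp [hin, pt, h.1]) fun h0 => ?_
    have := congrArg (fun v : R3 => v 1) h0
    simp [pt] at this
  · refine key (pt 0 (-b 2) (b 1)) (by simp [hin, pt]; ring) fun h0 => h ?_
    have h1 := congrArg (fun v : R3 => v 1) h0
    have h2 := congrArg (fun v : R3 => v 2) h0
    simp [pt] at h1 h2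
    exact ⟨h2, h1⟩

theorem inner_cross3_right (u v : R3) : ⟪cross3 u v, v⟫ = 0 := by
  simp [PiLp.inner_apply, Fin.sum_univ_three, cross3, pt]
  ring

end TripleProduct

noncomputable section FluxTube
open Set Filter Topology RealInnerProductSpace
open scoped ContDiff Real NNReal

theorem const_on_Icc_of_hasDerivAt_zero {F : Type*} [NormedAddCommGroup F] [NormedSpace ℝ F]
    {f : ℝ → F} {a b : ℝ} (h : ∀ t ∈ Icc a b, HasDerivAt f 0 t) {s t : ℝ} (hs : s ∈ Icc a b)
    (ht : t ∈ Icc a b) : f s = f t := by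
  have hc : ContinuousOn f (Icc a b) := fun t ht => (h t ht).continuousAt.continuousWithinAt
  have := constant_of_has_deriv_right_zero hc fun t ht =>
    (h t (Ico_subset_Icc_self ht)).hasDerivWithinAt
  rw [this s hs, this t ht]

/-- The variational equation along a family of integral curves. -/
theorem hasDerivAt_fderiv_of_integralCurves {Q : ℂ × ℝ → R3} {B : R3 → R3} (hQ : ContDiff ℝ ∞ Q)
    (hB : ContDiff ℝ ∞ B) (hd : ∀ w t, HasDerivAt (fun t => Q (w, t)) (B (Q (w, t))) t)
    (u : ℂ × ℝ) (w : ℂ) (t : ℝ) :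
    HasDerivAt (fun t => fderiv ℝ Q (w, t) u)
      (fderiv ℝ B (Q (w, t)) (fderiv ℝ Q (w, t) u)) t := by
  have hQd : ∀ q, HasFDerivAt Q (fderiv ℝ Q q) q := fun q =>
    (hQ.differentiable (by simp) q).hasFDerivAt
  have hQ' : ContDiff ℝ ∞ (fderiv ℝ Q) := hQ.fderiv_right (by simp)
  have hQd' : ∀ q, HasFDerivAt (fderiv ℝ Q) (fderiv ℝ (fderiv ℝ Q) q) q := fun q =>
    (hQ'.differentiable (by simp) q).hasFDerivAt
  have hl : ∀ w t, HasDerivAt (fun t : ℝ => ((w, t) : ℂ × ℝ)) (0, 1) t := fun w t =>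
    (hasDerivAt_const t w).prodMk (hasDerivAt_id t)
  have hX : ∀ q, fderiv ℝ Q q (0, 1) = B (Q q) := fun q =>
    ((hQd q).comp_hasDerivAt q.2 (hl q.1 q.2)).unique (hd q.1 q.2)
  have h1 : fderiv ℝ (fderiv ℝ Q) (w, t) u (0, 1) =
      fderiv ℝ B (Q (w, t)) (fderiv ℝ Q (w, t) u) := by
    have h2 : HasFDerivAt (fun q => fderiv ℝ Q q (0, 1))
        ((fderiv ℝ B (Q (w, t))).comp (fderiv ℝ Q (w, t))) (w, t) := by
      simp only [hX]
      exact (hB.differentiable (by simp) _).hasFDerivAt.comp _ (hQd _)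
    have h3 := ((hQd' (w, t)).clm_apply (hasFDerivAt_const ((0, 1) : ℂ × ℝ) (w, t))).unique h2
    have h4 := congrArg (fun L => L u) h3
    simpa using h4
  rw [← h1, second_derivative_symmetric (fun q => hQd q) (hQd' (w, t)) u (0, 1)]
  simpa using ((hQd' (w, t)).comp_hasDerivAt t (hl w t)).clm_apply (hasDerivAt_const t u)

theorem spaceJac_eq_of_divg_eq_zero {Q : ℂ × ℝ → R3} {B : R3 → R3} (hQ : ContDiff ℝ ∞ Q)
    (hB : ContDiff ℝ ∞ B) (hd : ∀ w t, HasDerivAt (fun t => Q (w, t)) (B (Q (w, t))) t) {w : ℂ}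
    {a b : ℝ} (hdiv : ∀ t ∈ Icc a b, divg B (Q (w, t)) = 0) {s t : ℝ} (hs : s ∈ Icc a b)
    (ht : t ∈ Icc a b) : spaceJac Q (w, s) = spaceJac Q (w, t) := by
  refine const_on_Icc_of_hasDerivAt_zero (f := fun t => spaceJac Q (w, t)) (fun t ht => ?_) hs ht
  have h := fun u => hasDerivAt_fderiv_of_integralCurves hQ hB hd u w t
  convert! hasDerivAt_triple (h (1, 0)) (h (Complex.I, 0)) (h (0, 1)) using 1
  have h1 := trace_mul_triple (fderiv ℝ B (Q (w, t))).toLinearMap (fderiv ℝ Q (w, t) (1, 0))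
    (fderiv ℝ Q (w, t) (Complex.I, 0)) (fderiv ℝ Q (w, t) (0, 1))
  have h2 : LinearMap.trace ℝ R3 (fderiv ℝ B (Q (w, t))).toLinearMap = 0 := hdiv t ht
  rw [h2, zero_mul] at h1
  exact h1

/-- Transverse coordinates at a point of the axis. -/
theorem exists_transverse_section {b z₀ : R3} {B : R3 → R3} {p : R3 → ℝ} (hB : ContDiff ℝ ∞ B)
    (hp : ContDiff ℝ ∞ p) (hb : B z₀ = b) (hb0 : b ≠ 0) (hp0 : fderiv ℝ p z₀ = 0)
    (hpos : ∀ u, u ≠ 0 → ⟪u, b⟫ = 0 → 0 < fderiv ℝ (fderiv ℝ p) z₀ u u) :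
    ∃ (σ : ℂ → R3) (P : ℝ → ℝ) (r : ℝ), ContDiff ℝ ∞ σ ∧ ContDiff ℝ ∞ P ∧ 0 < r ∧ σ 0 = z₀ ∧
      (∀ w, ‖w‖ < r → triple (fderiv ℝ σ w 1) (fderiv ℝ σ w Complex.I) (B (σ w)) = 1) ∧
      (∀ w, ‖w‖ < r → p (σ w) = P (‖w‖ ^ 2 / 2)) ∧
      ∀ w w', ‖w‖ < r → ‖w'‖ < r → (p (σ w) = p (σ w') ↔ ‖w‖ = ‖w'‖) := by
  subst hb
  obtain ⟨e, e', he, he', hee⟩ := exists_orthogonal_frame hb0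
  let l : ℂ →L[ℝ] R3 := Complex.reCLM.smulRight e + Complex.imCLM.smulRight e'
  have hl : ∀ u : ℂ, l u = u.re • e + u.im • e' := fun u => by simp [l]
  have hlt : ∀ u v c, triple (l u) (l v) c = planeDet u v * triple e e' c := fun u v c => by
    rw [hl, hl]; simp [triple, planeDet]; ring
  have hl0 : ∀ u : ℂ, u ≠ 0 → l u ≠ 0 := fun u hu h => hu <| by
    have h1 := hlt u (Complex.I * u) (B z₀)
    have h2 : planeDet u (Complex.I * u) = ‖u‖ ^ 2 := by
      rw [Complex.sq_norm, Complex.normSq_apply]; simp [planeDet]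
    rw [h, h2] at h1
    have h3 : ‖u‖ ^ 2 * triple e e' (B z₀) = 0 := by rw [← h1]; simp [triple]
    simpa using (mul_eq_zero.1 h3).resolve_right hee.ne'
  let s : ℂ → R3 := fun u => z₀ + l u
  have hs : ContDiff ℝ ∞ s := contDiff_const.add l.contDiff
  have hsd : ∀ u, HasFDerivAt s l u := fun u => l.hasFDerivAt.const_add z₀
  have hs0 : s 0 = z₀ := by simp [s]
  have hpd : ∀ z, HasFDerivAt p (fderiv ℝ p z) z := fun z =>
    (hp.differentiable (by simp) z).hasFDerivAt
  have hp' : ContDiff ℝ ∞ (fderiv ℝ p) := hp.fderiv_right (by simp)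
  have hpd' : ∀ z, HasFDerivAt (fderiv ℝ p) (fderiv ℝ (fderiv ℝ p) z) z := fun z =>
    (hp'.differentiable (by simp) z).hasFDerivAt
  have h1 : ∀ u, fderiv ℝ (fun u => p (s u)) u = (fderiv ℝ p (s u)).comp l := fun u =>
    ((hpd (s u)).comp u (hsd u)).fderiv
  have h2 : ∀ u, fderiv ℝ (fderiv ℝ (fun u => p (s u))) 0 u u =
      fderiv ℝ (fderiv ℝ p) z₀ (l u) (l u) := by
    intro u
    have h3 : fderiv ℝ (fun u => p (s u)) = fun u => (fderiv ℝ p (s u)).comp l := funext h1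
    have h4 : HasFDerivAt (fun u => (fderiv ℝ p (s u)).comp l) _ 0 :=
      ((hpd' (s 0)).comp (0 : ℂ) (hsd 0)).clm_comp (hasFDerivAt_const l (0 : ℂ))
    rw [h3, h4.fderiv, hs0]
    simp
  obtain ⟨κ, P, r, hκ, hP, hr, hκ0, hjac, hhP, hiff⟩ :=
    exists_planar_normal_form (h := fun u => p (s u)) (ρ := fun u => triple e e' (B (s u)))
      (hp.comp hs) (by rw [h1, hs0, hp0]; simp)
      (fun u hu => by
        rw [h2]
        refine hpos _ (hl0 u hu) ?_
        rw [hl, inner_add_left, inner_smul_left, inner_smul_left, he, he']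
        simp)
      (by
        have h3 : ContDiff ℝ ∞ fun u => B (s u) := hB.comp hs
        have h4 : ∀ i, ContDiff ℝ ∞ fun u => B (s u) i := fun i =>
          (EuclideanSpace.proj (𝕜 := ℝ) i : R3 →L[ℝ] ℝ).contDiff.comp h3
        unfold triple
        have h0 := h4 0
        have h1 := h4 1
        have h2 := h4 2
        fun_prop) (by simpa [hs0] using hee)
  refine ⟨fun w => s (κ w), P, r, hs.comp hκ, hP, hr, by simp [hκ0, hs0], fun w hw => ?_, hhP, hiff⟩
  have h3 : fderiv ℝ (fun w => s (κ w)) w = l.comp (fderiv ℝ κ w) :=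
    ((hsd (κ w)).comp w (hκ.differentiable (by simp) w).hasFDerivAt).fderiv
  rw [h3, ContinuousLinearMap.comp_apply, ContinuousLinearMap.comp_apply, hlt, mul_comm]
  exact hjac w hw

/-- A tube of integral curves around a periodic orbit, with radial `p` and unit Jacobian. -/
theorem exists_flux_tube {B : R3 → R3} {p : R3 → ℝ} {W : Set R3} {c : ℝ → R3} {T : ℝ}
    (hB : ContDiff ℝ ∞ B) (hBc : HasCompactSupport B) (hp : ContDiff ℝ ∞ p) (hW : IsOpen W)
    (hdiv : ∀ z ∈ W, divg B z = 0) (hBp : ∀ z ∈ W, fderiv ℝ p z (B z) = 0)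
    (hc : ∀ t, HasDerivAt c (B (c t)) t) (hcW : ∀ t, c t ∈ W) (hT : 0 < T)
    (hB0 : B (c 0) ≠ 0) (hp0 : fderiv ℝ p (c 0) = 0)
    (hpos : ∀ u, u ≠ 0 → ⟪u, B (c 0)⟫ = 0 → 0 < fderiv ℝ (fderiv ℝ p) (c 0) u u) :
    ∃ (Q : ℂ × ℝ → R3) (P : ℝ → ℝ) (r : ℝ), ContDiff ℝ ∞ Q ∧ ContDiff ℝ ∞ P ∧ 0 < r ∧
      (∀ t, Q (0, t) = c t) ∧ (∀ w t, HasDerivAt (fun t => Q (w, t)) (B (Q (w, t))) t) ∧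
      (∀ w w' t t', Q (w, t) = Q (w', t') → ∀ s, Q (w, t + s) = Q (w', t' + s)) ∧
      (∀ (w : ℂ) (t : ℝ), ‖w‖ < r → t ∈ Icc (-T) (2 * T) →
        Q (w, t) ∈ W ∧ p (Q (w, t)) = P (‖w‖ ^ 2 / 2) ∧ spaceJac Q (w, t) = 1) ∧
      ∀ w w' : ℂ, ‖w‖ < r → ‖w'‖ < r → P (‖w‖ ^ 2 / 2) = P (‖w'‖ ^ 2 / 2) → ‖w‖ = ‖w'‖ := by
  obtain ⟨σ, P, r, hσ, hP, hr, hσ0, hjac, hpP, hiff⟩ :=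
    exists_transverse_section hB hp rfl hB0 hp0 hpos
  obtain ⟨M, hM⟩ := hB.continuous.bounded_above_of_compact_support hBc
  obtain ⟨K, hK⟩ := (contDiff_infty.1 hB 1).lipschitzWith_of_hasCompactSupport hBc (by simp)
  obtain ⟨F, hF, hF0, hFd, hFadd, hFu⟩ := exists_contDiff_flow (M := M.toNNReal) hB
    (fun x => (hM x).trans (Real.le_coe_toNNReal M)) hK
  let Q : ℂ × ℝ → R3 := fun q => F (q.2, σ q.1)
  have hQ : ContDiff ℝ ∞ Q := hF.comp (contDiff_snd.prodMk (hσ.comp contDiff_fst))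
  have hQ0 : ∀ t, Q (0, t) = c t := fun t => by
    simp only [Q, hσ0]
    exact (hFu c hc t).symm
  have hQd : ∀ w t, HasDerivAt (fun t => Q (w, t)) (B (Q (w, t))) t := fun w t => hFd t (σ w)
  have hQσ : ∀ w, Q (w, 0) = σ w := fun w => hF0 _
  obtain ⟨u, v, hu, -, hu0, hv, huv⟩ := generalized_tube_lemma (isCompact_singleton (x := (0 : ℂ)))
    (isCompact_Icc (a := -T) (b := 2 * T)) (hW.preimage hQ.continuous) (by
      rintro ⟨w, t⟩ ⟨hw, -⟩
      rw [mem_singleton_iff] at hw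
      simp only at hw
      simp only [mem_preimage, hw, hQ0]
      exact hcW t)
  obtain ⟨r', hr', hball⟩ := Metric.isOpen_iff.1 hu 0 (hu0 rfl)
  have hQW : ∀ w t, ‖w‖ < r' → t ∈ Icc (-T) (2 * T) → Q (w, t) ∈ W := fun w t hw ht =>
    huv (mk_mem_prod (hball (by simpa using hw)) (hv ht))
  have h0I : (0 : ℝ) ∈ Icc (-T) (2 * T) := ⟨by linarith, by linarith⟩
  refine ⟨Q, P, min r r', hQ, hP, lt_min hr hr', hQ0, hQd, fun w w' t t' h s => ?_,
    fun w t hw ht => ⟨hQW w t (hw.trans_le (min_le_right _ _)) ht, ?_, ?_⟩,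
    fun w w' hw hw' h => ?_⟩
  · simp only [Q] at h ⊢
    rw [add_comm t, add_comm t', hFadd, hFadd, h]
  · rw [← hpP w (hw.trans_le (min_le_left _ _)), ← hQσ w]
    refine const_on_Icc_of_hasDerivAt_zero (f := fun t => p (Q (w, t))) (fun t ht => ?_) ht h0I
    have h1 := (hp.differentiable (by simp) (Q (w, t))).hasFDerivAt.comp_hasDerivAt t (hQd w t)
    rwa [hBp _ (hQW w t (hw.trans_le (min_le_right _ _)) ht)] at h1
  · rw [spaceJac_eq_of_divg_eq_zero hQ hB hQd
      (fun t ht => hdiv _ (hQW w t (hw.trans_le (min_le_right _ _)) ht)) ht h0I,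
      ← hjac w (hw.trans_le (min_le_left _ _))]
    have hQf : HasFDerivAt Q (fderiv ℝ Q (w, 0)) (w, 0) :=
      (hQ.differentiable (by simp) _).hasFDerivAt
    have h1 : ∀ v, fderiv ℝ Q (w, 0) (v, 0) = fderiv ℝ σ w v := fun v => by
      have h2 := HasFDerivAt.comp w (g := Q) (f := fun w => (w, (0 : ℝ))) hQf
        ((hasFDerivAt_id w).prodMk (hasFDerivAt_const (0 : ℝ) w))
      simp only [Function.comp_def, hQσ] at h2
      rw [h2.fderiv]
      simp
    have h2 : fderiv ℝ Q (w, 0) (0, 1) = B (σ w) := by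
      rw [← hQσ]
      exact (hQf.comp_hasDerivAt (0 : ℝ)
        ((hasDerivAt_const (0 : ℝ) w).prodMk (hasDerivAt_id (0 : ℝ)))).unique (hQd w 0)
    rw [spaceJac, h1, h1, h2]
  · have hw₁ := hw.trans_le (min_le_left _ _)
    have hw₂ := hw'.trans_le (min_le_left _ _)
    rw [← hiff w w' hw₁ hw₂, hpP w hw₁, hpP w' hw₂, h]

end FluxTube

noncomputable section ReturnMap
open Set Filter Topology RealInnerProductSpace
open scoped ContDiff Real

/-- A nonconstant closed orbit has a minimal period. -/
theorem exists_minimal_period {E : Type*} [TopologicalSpace E] [T2Space E] {c : ℝ → E} {T : ℝ}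
    (hc : Continuous c) (huniq : ∀ s t, c s = c t → ∀ u, c (s + u) = c (t + u))
    (hT : 0 < T) (hper : ∀ t, c (t + T) = c t) (hne : ∃ t, c t ≠ c 0) :
    ∃ T₀, 0 < T₀ ∧ (∀ t, c (t + T₀) = c t) ∧
      ∀ s t, c s = c t → ∃ n : ℤ, s - t = n * T₀ := by
  let G : AddSubgroup ℝ :=
    { carrier := {τ | ∀ t, c (t + τ) = c t}
      zero_mem' := fun t => by simp
      add_mem' := fun {a b} ha hb t => by
        rw [← add_assoc, hb, ha]
      neg_mem' := fun {a} ha t => by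
        rw [← ha (t + -a)]; simp }
  have hGc : IsClosed (G : Set ℝ) := by
    have : (G : Set ℝ) = ⋂ t, {τ | c (t + τ) = c t} := by ext; simp [G]
    rw [this]
    exact isClosed_iInter fun t => isClosed_eq (by fun_prop) continuous_const
  have hmem : ∀ τ, τ ∈ G ↔ ∀ t, c (t + τ) = c t := fun τ => Iff.rfl
  rcases G.dense_or_cyclic with hd | ⟨a, ha⟩
  · obtain ⟨t, ht⟩ := hne
    have : t ∈ (G : Set ℝ) := by rw [hGc.closure_eq.symm, hd.closure_eq]; trivial
    exact absurd (by simpa using this 0) ht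
  · rw [← AddSubgroup.zmultiples_eq_closure] at ha
    have ha0 : a ≠ 0 := by
      rintro rfl
      have : T ∈ G := hper
      rw [ha] at this
      simp at this
      exact hT.ne' this
    have haG : |a| ∈ G := by
      rcases abs_choice a with h | h <;> rw [h]
      · rw [ha]; exact AddSubgroup.mem_zmultiples a
      · rw [ha]; exact neg_mem (AddSubgroup.mem_zmultiples a)
    refine ⟨|a|, abs_pos.2 ha0, haG, fun s t hst => ?_⟩
    have h1 : s - t ∈ G := fun u => by
      have := huniq s t hst (u - t)
      rw [show u + (s - t) = s + (u - t) by ring, this]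
      congr 1
      ring
    rw [ha, AddSubgroup.mem_zmultiples_iff] at h1
    obtain ⟨n, hn⟩ := h1
    rw [← hn]
    rcases abs_choice a with h | h <;> rw [h]
    · exact ⟨n, by simp⟩
    · exact ⟨-n, by simp⟩

theorem smul_integral_deriv_eq {g : ℝ → ℂ} (hg : ContDiff ℝ ∞ g) (h0 : g 0 = 0) (x : ℝ) :
    (x : ℂ) * ∫ t in (0 : ℝ)..1, deriv g (t * x) = g x := by
  have hg' : Continuous (deriv g) := hg.continuous_deriv (by simp)
  have h1 : ∀ t : ℝ, HasDerivAt (fun t => g (t * x)) ((x : ℂ) * deriv g (t * x)) t := fun t => by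
    have h2 : HasDerivAt (fun t : ℝ => t * x) x t := by
      simpa using (hasDerivAt_id t).mul_const x
    have h3 := HasDerivAt.scomp t (hg.differentiable (by simp) (t * x)).hasDerivAt h2
    rw [Complex.real_smul] at h3
    exact h3
  rw [← intervalIntegral.integral_const_mul,
    intervalIntegral.integral_eq_sub_of_hasDerivAt (fun t _ => h1 t)
      (Continuous.intervalIntegrable (by fun_prop) _ _)]
  simp [h0]

/-- Smooth area-preserving maps which preserve the distance to the origin are twists. -/
theorem exists_twist {f : ℂ → ℂ} (hf : ContDiff ℝ ∞ f) (hn : ∀ᶠ w in 𝓝 0, ‖f w‖ = ‖w‖)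
    (hj : ∀ᶠ w in 𝓝 0, planeJac f w = 1) :
    ∃ G : ℝ → ℝ, ContDiff ℝ ∞ G ∧ ∀ᶠ w in 𝓝 0, f w = rotFactor (G (‖w‖ ^ 2 / 2)) * w := by
  have hfd : ∀ w, HasFDerivAt f (fderiv ℝ f w) w := fun w =>
    (hf.differentiable (by simp) w).hasFDerivAt
  have hf0 : f 0 = 0 := by simpa using hn.self_of_nhds
  have hrotder : ∀ᶠ w in 𝓝 0, fderiv ℝ f w (Complex.I * w) = Complex.I * f w := by
    filter_upwards [hn.eventually_nhds, hj] with w h1 h2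
    have h3 : ∀ v, (f w).re * (fderiv ℝ f w v).re + (f w).im * (fderiv ℝ f w v).im =
        w.re * v.re + w.im * v.im := by
      intro v
      have h4 : (fun w => ‖f w‖ ^ 2) =ᶠ[𝓝 w] fun w => ‖w‖ ^ 2 := by
        filter_upwards [h1] with w h
        rw [h]
      have h5 := ((hfd w).norm_sq.congr_of_eventuallyEq h4.symm).unique (hasFDerivAt_id w).norm_sq
      have h6 := congrArg (fun L => L v) h5
      simp [Complex.inner] at h6
      linarith
    have h7 := planeDet_apply (fderiv ℝ f w) w (Complex.I * w)
    have h8 : planeDet (fderiv ℝ f w 1) (fderiv ℝ f w Complex.I) = 1 := h2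
    rw [h8] at h7
    have h9 := h3 w
    have h10 := h3 (Complex.I * w)
    have h11 : (f w).re ^ 2 + (f w).im ^ 2 = w.re ^ 2 + w.im ^ 2 := by
      have := congrArg (· ^ 2) h1.self_of_nhds
      simp only [Complex.sq_norm, Complex.normSq_apply] at this
      linarith
    by_cases hw : w.re ^ 2 + w.im ^ 2 = 0
    · have hw0 : w = 0 := by
        apply Complex.ext <;> simp <;> nlinarith [sq_nonneg w.re, sq_nonneg w.im]
      simp [hw0, hf0]
    simp [planeDet] at h7 h10
    generalize fderiv ℝ f w w = a at *
    generalize fderiv ℝ f w (Complex.I * w) = b at *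
    generalize f w = y at *
    have hyb : y.re * b.im - y.im * b.re = w.re ^ 2 + w.im ^ 2 := by
      have : (w.re ^ 2 + w.im ^ 2) * (y.re * b.im - y.im * b.re - (w.re ^ 2 + w.im ^ 2)) = 0 := by
        linear_combination (y.im * b.re - y.re * b.im) * h9 + (y.re ^ 2 + y.im ^ 2) * h7 +
          (w.re ^ 2 + w.im ^ 2) * h11 + (y.re * a.im - y.im * a.re) * h10
      linarith [(mul_eq_zero.1 this).resolve_left hw]
    have hb1 : (w.re ^ 2 + w.im ^ 2) * (b.re + y.im) = 0 := by
      linear_combination -b.re * h11 + y.re * h10 - y.im * hyb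
    have hb2 : (w.re ^ 2 + w.im ^ 2) * (b.im - y.re) = 0 := by
      linear_combination -b.im * h11 + y.im * h10 + y.re * hyb
    apply Complex.ext
    · simp; linarith [(mul_eq_zero.1 hb1).resolve_left hw]
    · simp; linarith [(mul_eq_zero.1 hb2).resolve_left hw]
  obtain ⟨r, hr, hball⟩ := Metric.eventually_nhds_iff.1 (hn.and hrotder)
  simp only [dist_zero_right] at hball
  have hrot : ∀ w, ‖w‖ < r → ∀ s, f (rotFactor s * w) = rotFactor s * f w := by
    intro w hw s
    have h1 : ∀ s, HasDerivAt (fun s => rotFactor (-s) * f (rotFactor s * w)) 0 s := by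
      intro s
      have h2 : HasDerivAt (fun s => rotFactor (-s)) (-(rotFactor (-s) * Complex.I)) s := by
        have := HasDerivAt.scomp s (hasDerivAt_rotFactor (-s)) (hasDerivAt_neg s)
        rw [neg_one_smul] at this
        exact this
      have h3 : HasDerivAt (fun s => f (rotFactor s * w)) (Complex.I * f (rotFactor s * w)) s := by
        rw [← (hball (y := rotFactor s * w) (by simpa using hw)).2]
        have := (hfd (rotFactor s * w)).comp_hasDerivAt s ((hasDerivAt_rotFactor s).mul_const w)
        rwa [show rotFactor s * Complex.I * w = Complex.I * (rotFactor s * w) by ring] at this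
      convert! h2.mul h3 using 1
      ring
    have h4 := is_const_of_deriv_eq_zero (fun s => (h1 s).differentiableAt) (fun s => (h1 s).deriv)
      s 0
    simp only [neg_zero, rotFactor_zero, one_mul] at h4
    rw [← h4, ← mul_assoc, ← rotFactor_add]
    simp
  let g : ℝ → ℂ := fun x => f (x : ℂ)
  have hg : ContDiff ℝ ∞ g := hf.comp Complex.ofRealCLM.contDiff
  have hg' : ContDiff ℝ ∞ (deriv g) := by simpa using hg.iterate_deriv 1
  let k : ℝ → ℂ := fun x => ∫ t in (0 : ℝ)..1, deriv g (t * x)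
  have hk : ContDiff ℝ ∞ k := contDiff_intervalIntegral_of_contDiff
    (f := fun q : ℝ × ℝ => deriv g (q.2 * q.1)) (hg'.comp (contDiff_snd.mul contDiff_fst))
    zero_le_one
  have hfk : ∀ x : ℝ, f x = x * k x := fun x =>
    (smul_integral_deriv_eq hg (by simp [g, hf0]) x).symm
  clear_value k
  have hk1 : ∀ x : ℝ, |x| < r → x ≠ 0 → ‖k x‖ = 1 := by
    intro x hx hx0
    have h1 := (hball (y := (x : ℂ)) (by simpa using hx)).1
    rw [hfk, norm_mul] at h1
    have h2 : ‖(x : ℂ)‖ ≠ 0 := by simpa using hx0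
    exact mul_left_cancel₀ h2 (by rw [h1, mul_one])
  have hev : ∀ᶠ x : ℝ in 𝓝 0, |x| < r := by
    filter_upwards [Metric.ball_mem_nhds (0 : ℝ) hr] with x hx
    simpa using hx
  have hk0 : ‖k 0‖ = 1 := by
    refine tendsto_nhds_unique (l := 𝓝[≠] (0 : ℝ)) (f := fun x => ‖k x‖)
      ((hk.continuous.norm.tendsto 0).mono_left nhdsWithin_le_nhds)
      (tendsto_const_nhds.congr' ?_)
    filter_upwards [hev.filter_mono nhdsWithin_le_nhds, self_mem_nhdsWithin] with x hx hx0
    exact (hk1 x hx hx0).symm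
  have hk1' : ∀ x : ℝ, |x| < r → ‖k x‖ = 1 := fun x hx => by
    rcases eq_or_ne x 0 with rfl | h
    exacts [hk0, hk1 x hx h]
  have hkeven : ∀ x : ℝ, |x| < r → k (-x) = k x := by
    intro x hx
    rcases eq_or_ne x 0 with rfl | h
    · simp
    have h1 := hrot x (by simpa using hx) π
    have h2 : rotFactor π = -1 := by simp [rotFactor, Complex.exp_pi_mul_I]
    rw [h2, neg_one_mul, neg_one_mul, ← Complex.ofReal_neg, hfk, hfk] at h1
    have h3 : (x : ℂ) ≠ 0 := by exact_mod_cast h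
    refine mul_left_cancel₀ h3 ?_
    push_cast at h1
    linear_combination -h1
  have hk00 : k 0 ≠ 0 := norm_ne_zero_iff.1 (by rw [hk0]; exact one_ne_zero)
  let θ : ℝ → ℝ := fun x => (k 0).arg + (k x / k 0).arg
  have hθ : ∀ x : ℝ, |x| < r → k x = rotFactor (θ x) := by
    intro x hx
    have h1 := eq_rotFactor_arg_mul (k 0)
    have h2 := eq_rotFactor_arg_mul (k x / k 0)
    rw [norm_div, hk1' x hx, hk0] at h2
    rw [hk0] at h1
    simp only [div_one, Complex.ofReal_one, mul_one] at h1 h2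
    simp only [θ, rotFactor_add]
    rw [← h1, ← h2, mul_div_cancel₀ _ hk00]
  have hθs : ∀ᶠ x in 𝓝 0, ContDiffAt ℝ ∞ θ x := by
    have h1 : ContDiff ℝ ∞ fun x => k x / k 0 := hk.div_const _
    have h2 : ∀ᶠ x in 𝓝 0, k x / k 0 ∈ Complex.slitPlane :=
      h1.continuous.continuousAt.eventually (Complex.isOpen_slitPlane.mem_nhds (by simp [hk00]))
    filter_upwards [h2] with x hx
    have h4 : ContDiffAt ℝ ∞ Complex.log (k x / k 0) :=
      (Complex.contDiffAt_log hx).restrict_scalars ℝ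
    have h5 : ContDiffAt ℝ ∞ (fun x => Complex.log (k x / k 0)) x :=
      ContDiffAt.comp (g := Complex.log) x h4 h1.contDiffAt
    have h3 : ContDiffAt ℝ ∞ (fun x => (Complex.log (k x / k 0)).im) x :=
      Complex.imCLM.contDiff.contDiffAt.comp x h5
    simp only [Complex.log_im] at h3
    exact contDiffAt_const.add h3
  obtain ⟨θ', hθ', hθθ⟩ := exists_contDiff_eventuallyEq hθs
  have hneg : Tendsto (fun x : ℝ => -x) (𝓝 0) (𝓝 0) := by
    simpa using (continuous_neg (G := ℝ)).tendsto 0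
  obtain ⟨q, hq, hqe⟩ := exists_contDiff_comp_sq hθ' (by
    filter_upwards [hθθ, hneg.eventually hθθ, hev] with x h1 h2 h3
    rw [h1, h2]
    simp only [θ, hkeven x h3])
  refine ⟨fun s => q (2 * s), hq.comp (contDiff_const.mul contDiff_id), ?_⟩
  have hnt : Tendsto (fun w : ℂ => ‖w‖) (𝓝 0) (𝓝 0) := by
    simpa using (continuous_norm (E := ℂ)).tendsto 0
  filter_upwards [hnt.eventually hqe, hnt.eventually hθθ, hnt.eventually hev] with w h1 h2 h3
  rw [mul_div_cancel₀ _ two_ne_zero, ← h1, h2, ← hθ _ h3]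
  conv_lhs => rw [eq_rotFactor_arg_mul w]
  rw [hrot _ (by simpa using h3), hfk, ← mul_assoc, ← eq_rotFactor_arg_mul, mul_comm]

/-- The first return map of a flux tube around a closed orbit. -/
theorem exists_return_map {Q : ℂ × ℝ → R3} {p : R3 → ℝ} {P : ℝ → ℝ} {r T : ℝ}
    (hQ : ContDiff ℝ ∞ Q) (hr : 0 < r) (hT : 0 < T)
    (hshift : ∀ w w' t t', Q (w, t) = Q (w', t') → ∀ s, Q (w, t + s) = Q (w', t' + s))
    (htube : ∀ (w : ℂ) (t : ℝ), ‖w‖ < r → t ∈ Icc (-T) (2 * T) →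
      p (Q (w, t)) = P (‖w‖ ^ 2 / 2) ∧ spaceJac Q (w, t) = 1)
    (hP : ∀ w w' : ℂ, ‖w‖ < r → ‖w'‖ < r → P (‖w‖ ^ 2 / 2) = P (‖w'‖ ^ 2 / 2) → ‖w‖ = ‖w'‖)
    (hper : Q (0, T) = Q (0, 0)) :
    ∃ (G : ℝ → ℝ) (τ : ℂ → ℝ), ContDiff ℝ ∞ G ∧ ContDiff ℝ ∞ τ ∧ τ 0 = T ∧
      ∀ᶠ w in 𝓝 0, ∀ t, Q (rotFactor (G (‖w‖ ^ 2 / 2)) * w, t) = Q (w, t + τ w) := by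
  have h0I : (0 : ℝ) ∈ Icc (-T) (2 * T) := ⟨by linarith, by linarith⟩
  have hTI : T ∈ Icc (-T) (2 * T) := ⟨by linarith, by linarith⟩
  have hjac : ∀ (w : ℂ) (t : ℝ), ‖w‖ < r → t ∈ Icc (-T) (2 * T) → spaceJac Q (w, t) = 1 :=
    fun w t hw ht => (htube w t hw ht).2
  have hQd : ∀ q, HasFDerivAt Q (fderiv ℝ Q q) q := fun q =>
    (hQ.differentiable (by simp) q).hasFDerivAt
  obtain ⟨R, hR, hR0, hQR, -⟩ := exists_contDiff_localInverse (a := ((0, 0) : ℂ × ℝ)) hQ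
    (isInvertible_of_triple_ne_zero (by
      have := hjac 0 0 (by simpa using hr) h0I
      rw [spaceJac] at this
      rw [this]
      exact one_ne_zero))
  have hRQ : ContDiff ℝ ∞ fun w => R (Q (w, T)) :=
    hR.comp (hQ.comp (contDiff_id.prodMk contDiff_const))
  let f : ℂ → ℂ := fun w => (R (Q (w, T))).1
  let s : ℂ → ℝ := fun w => (R (Q (w, T))).2
  have hf : ContDiff ℝ ∞ f := contDiff_fst.comp hRQ
  have hs : ContDiff ℝ ∞ s := contDiff_snd.comp hRQ
  have hf0 : f 0 = 0 := by simp [f, hper, hR0]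
  have hs0 : s 0 = 0 := by simp [s, hper, hR0]
  have hQT : Tendsto (fun w : ℂ => Q (w, T)) (𝓝 0) (𝓝 (Q (0, 0))) := by
    rw [← hper]
    exact (hQ.comp (contDiff_id.prodMk contDiff_const)).continuous.tendsto 0
  have hfs : ∀ᶠ w in 𝓝 0, Q (f w, s w) = Q (w, T) := hQT.eventually hQR
  clear_value f s
  have hft : Tendsto f (𝓝 0) (𝓝 0) := by simpa [hf0] using hf.continuous.tendsto 0
  have hst : Tendsto s (𝓝 0) (𝓝 0) := by simpa [hs0] using hs.continuous.tendsto 0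
  have hsmall : ∀ᶠ w : ℂ in 𝓝 0, ‖w‖ < r := by
    filter_upwards [Metric.ball_mem_nhds (0 : ℂ) hr] with x hx
    simpa using hx
  have hsI : ∀ᶠ w in 𝓝 0, s w ∈ Icc (-T) (2 * T) :=
    hst.eventually (Icc_mem_nhds (by linarith) (by linarith))
  have hn : ∀ᶠ w in 𝓝 0, ‖f w‖ = ‖w‖ := by
    filter_upwards [hfs, hsmall, hft.eventually hsmall, hsI] with w h1 h2 h3 h4
    refine hP _ _ h3 h2 ?_
    rw [← (htube _ _ h3 h4).1, h1, (htube _ _ h2 hTI).1]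
  have hj : ∀ᶠ w in 𝓝 0, planeJac f w = 1 := by
    filter_upwards [hfs.eventually_nhds, hsmall, hft.eventually hsmall, hsI] with w h1 h2 h3 h4
    have hfd := (hf.differentiable (by simp) w).hasFDerivAt
    have hsd := (hs.differentiable (by simp) w).hasFDerivAt
    let pf := ContinuousLinearMap.fst ℝ ℂ ℝ
    let ps := ContinuousLinearMap.snd ℝ ℂ ℝ
    have hM : HasFDerivAt (fun q : ℂ × ℝ => (f q.1, s q.1 + q.2))
        (((fderiv ℝ f w).comp pf).prod ((fderiv ℝ s w).comp pf + ps)) (w, 0) :=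
      (HasFDerivAt.comp (g := f) (w, (0 : ℝ)) hfd pf.hasFDerivAt).prodMk
        ((HasFDerivAt.comp (g := s) (w, (0 : ℝ)) hsd pf.hasFDerivAt).add ps.hasFDerivAt)
    have hN : HasFDerivAt (fun q : ℂ × ℝ => (q.1, T + q.2)) (pf.prod ps) (w, 0) :=
      pf.hasFDerivAt.prodMk (ps.hasFDerivAt.const_add T)
    have h5 := HasFDerivAt.comp (g := Q) (w, (0 : ℝ)) (hQd (f w, s w + 0)) hM
    have h6 := HasFDerivAt.comp (g := Q) (w, (0 : ℝ)) (hQd (w, T + 0)) hN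
    have h7 : Q ∘ (fun q : ℂ × ℝ => (f q.1, s q.1 + q.2)) =ᶠ[𝓝 (w, 0)]
        Q ∘ (fun q : ℂ × ℝ => (q.1, T + q.2)) := by
      filter_upwards [continuous_fst.continuousAt.eventually h1] with q hq
      exact hshift _ _ _ _ hq q.2
    have h8 := h5.unique (h6.congr_of_eventuallyEq h7)
    rw [add_zero, add_zero] at h8
    have h9 := triple_apply (fderiv ℝ Q (f w, s w)) (fderiv ℝ f w 1, fderiv ℝ s w 1)
      (fderiv ℝ f w Complex.I, fderiv ℝ s w Complex.I) (0, 1)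
    have h10 : ∀ v : ℂ × ℝ, fderiv ℝ Q (f w, s w) (fderiv ℝ f w v.1, fderiv ℝ s w v.1 + v.2) =
        fderiv ℝ Q (w, T) v := fun v => by
      simpa [pf, ps] using congrArg (fun L => L v) h8
    have h11 := h10 (1, 0)
    have h12 := h10 (Complex.I, 0)
    have h13 := h10 (0, 1)
    simp only [add_zero, map_zero, zero_add] at h11 h12 h13
    have h14 := hjac _ _ h2 hTI
    have h15 := hjac _ _ h3 h4
    rw [spaceJac] at h14 h15
    rw [h15, h11, h12, h13, h14] at h9
    simp [spaceDet, planeDet] at h9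
    simp [planeJac, planeDet]
    linarith
  obtain ⟨G, hG, hGf⟩ := exists_twist hf hn hj
  refine ⟨G, fun w => T - s w, hG, contDiff_const.sub hs, by simp [hs0], ?_⟩
  filter_upwards [hGf, hfs] with w h1 h2 t
  rw [← h1]
  have := hshift _ _ _ _ h2 (t - s w)
  convert this using 3 <;> ring

end ReturnMap

noncomputable section Suspension
open Set Filter Topology RealInnerProductSpace
open scoped ContDiff Real

theorem planeDet_rotFactor_mul (t : ℝ) (u v : ℂ) :
    planeDet (rotFactor t * u) (rotFactor t * v) = planeDet u v := by
  have h : (rotFactor t).re ^ 2 + (rotFactor t).im ^ 2 = 1 := by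
    have := congrArg (· ^ 2) (norm_rotFactor t)
    simp only [Complex.sq_norm, Complex.normSq_apply] at this
    linarith
  simp only [planeDet, Complex.mul_re, Complex.mul_im]
  linear_combination (u.re * v.im - u.im * v.re) * h

theorem planeJac_twist {a : ℝ → ℝ} {a' : ℝ} {z : ℂ} (ha : HasDerivAt a a' (‖z‖ ^ 2)) :
    planeJac (fun z => rotFactor (a (‖z‖ ^ 2)) * z) z = 1 := by
  have h1 : HasFDerivAt (fun z : ℂ => ‖z‖ ^ 2) _ z := (hasFDerivAt_id z).norm_sq
  have h2 : HasFDerivAt (fun z : ℂ => a (‖z‖ ^ 2)) _ z := HasDerivAt.comp_hasFDerivAt z ha h1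
  have h3 : HasFDerivAt (fun z : ℂ => rotFactor (a (‖z‖ ^ 2))) _ z :=
    HasFDerivAt.comp (g := rotFactor) (f := fun z : ℂ => a (‖z‖ ^ 2)) z
      (hasDerivAt_rotFactor (a (‖z‖ ^ 2))).hasFDerivAt h2
  have h4 := h3.mul (hasFDerivAt_id z)
  have h5 : ∀ v, fderiv ℝ (fun z => rotFactor (a (‖z‖ ^ 2)) * z) z v =
      rotFactor (a (‖z‖ ^ 2)) *
        (v + ((a' * (2 * (z.re * v.re + z.im * v.im)) : ℝ) : ℂ) * Complex.I * z) := by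
    intro v
    have h6 := congrArg (fun L => L v) h4.fderiv
    refine h6.trans ?_
    simp [Complex.inner]
    ring
  rw [planeJac, h5, h5, planeDet_rotFactor_mul]
  simp [planeDet]
  ring

theorem spaceJac_comp_twist {Q : ℂ × ℝ → R3} {tw : ℂ × ℝ → ℂ} {m : ℂ × ℝ → ℝ} {q : ℂ × ℝ}
    (hQ : DifferentiableAt ℝ Q (tw q, m (tw q, q.2))) (htw : DifferentiableAt ℝ tw q)
    (hm : DifferentiableAt ℝ m (tw q, q.2)) :
    spaceJac (fun q => Q (tw q, m (tw q, q.2))) q = spaceJac Q (tw q, m (tw q, q.2)) *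
      (planeDet (fderiv ℝ tw q (1, 0)) (fderiv ℝ tw q (Complex.I, 0)) *
        fderiv ℝ m (tw q, q.2) (0, 1)) := by
  have h1 := HasFDerivAt.comp (g := m) (f := fun q => (tw q, q.2)) q hm.hasFDerivAt
    (htw.hasFDerivAt.prodMk hasFDerivAt_snd)
  have h2 := HasFDerivAt.comp (g := Q) (f := fun q => (tw q, m (tw q, q.2))) q hQ.hasFDerivAt
    (htw.hasFDerivAt.prodMk h1)
  have h3 : ∀ v, fderiv ℝ (fun q => Q (tw q, m (tw q, q.2))) q v =
      fderiv ℝ Q (tw q, m (tw q, q.2))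
        (fderiv ℝ tw q v, fderiv ℝ m (tw q, q.2) (fderiv ℝ tw q v, v.2)) := by
    intro v
    have h4 := congrArg (fun L => L v) h2.fderiv
    refine h4.trans ?_
    simp
  obtain ⟨a, b, c, hc, h5⟩ : ∃ a b c : ℝ, fderiv ℝ m (tw q, q.2) (0, 1) = c ∧
      ∀ (v : ℂ) (s : ℝ), fderiv ℝ m (tw q, q.2) (v, s) = v.re * a + v.im * b + s * c := by
    refine ⟨fderiv ℝ m (tw q, q.2) (1, 0), fderiv ℝ m (tw q, q.2) (Complex.I, 0), _, rfl,
      fun v s => ?_⟩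
    rw [← smul_eq_mul, ← smul_eq_mul, ← smul_eq_mul, ← map_smul, ← map_smul, ← map_smul, ← map_add,
      ← map_add]
    congr 1
    refine Prod.ext (Complex.ext ?_ ?_) ?_ <;> simp
  rw [spaceJac, h3, h3, h3, triple_apply, spaceJac]
  rw [hc]
  congr 1
  simp only [h5, spaceDet, planeDet]
  ring

/-- Closing up a flux tube into a solid torus. -/
theorem exists_suspension {Q : ℂ × ℝ → R3} {B : R3 → R3} {p : R3 → ℝ} {P G : ℝ → ℝ} {W : Set R3}
    {τ : ℂ → ℝ} {r T : ℝ} (hQ : ContDiff ℝ ∞ Q) (hG : ContDiff ℝ ∞ G) (hτ : ContDiff ℝ ∞ τ)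
    (hr : 0 < r) (hT : 0 < T) (hτ0 : τ 0 = T)
    (hQd : ∀ w t, HasDerivAt (fun t => Q (w, t)) (B (Q (w, t))) t)
    (htube : ∀ (w : ℂ) (t : ℝ), ‖w‖ < r → t ∈ Icc (-T) (2 * T) →
      Q (w, t) ∈ W ∧ p (Q (w, t)) = P (‖w‖ ^ 2 / 2) ∧ spaceJac Q (w, t) = 1)
    (hret : ∀ᶠ w in 𝓝 0, ∀ t, Q (rotFactor (G (‖w‖ ^ 2 / 2)) * w, t) = Q (w, t + τ w)) :
    ∃ (Φ : ℂ × ℝ → R3) (r' : ℝ), 0 < r' ∧ (∀ z θ, Φ (z, θ + 1) = Φ (z, θ)) ∧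
      (∀ θ, Φ (0, θ) = Q (0, T * Int.fract θ)) ∧
      ∀ (z : ℂ) (θ : ℝ), ‖z‖ < r' → ContDiffAt ℝ ∞ Φ (z, θ) ∧ Φ (z, θ) ∈ W ∧
        p (Φ (z, θ)) = P (‖z‖ ^ 2 / 2) ∧ 0 < spaceJac Φ (z, θ) ∧
        fderiv ℝ Φ (z, θ) (G (‖z‖ ^ 2 / 2) * (Complex.I * z), 1) =
          spaceJac Φ (z, θ) • B (Φ (z, θ)) := by
  let S : ℝ → ℝ := fun θ => Real.smoothTransition (2 * θ - 1 / 2)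
  have hS : ContDiff ℝ ∞ S := Real.smoothTransition.contDiff.comp
    ((contDiff_const.mul contDiff_id).sub contDiff_const)
  have hS0 : ∀ θ, θ ≤ 1 / 4 → S θ = 0 := fun θ hθ =>
    Real.smoothTransition.zero_of_nonpos (by linarith)
  have hS1 : ∀ θ, 3 / 4 ≤ θ → S θ = 1 := fun θ hθ =>
    Real.smoothTransition.one_of_one_le (by linarith)
  clear_value S
  let m : ℂ × ℝ → ℝ := fun q => T * q.2 + S q.2 * (τ q.1 - T)
  have hm : ContDiff ℝ ∞ m := (contDiff_const.mul contDiff_snd).add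
    ((hS.comp contDiff_snd).mul ((hτ.comp contDiff_fst).sub contDiff_const))
  have hm0 : ∀ θ, m (0, θ) = T * θ := fun θ => by simp [m, hτ0]
  have hl : ∀ (w : ℂ) (θ : ℝ), HasDerivAt (fun θ : ℝ => ((w, θ) : ℂ × ℝ)) (0, 1) θ := fun w θ =>
    (hasDerivAt_const θ w).prodMk (hasDerivAt_id θ)
  have hmd : ∀ w θ, HasDerivAt (fun θ => m (w, θ)) (fderiv ℝ m (w, θ) (0, 1)) θ := fun w θ =>
    (hm.differentiable (by simp) (w, θ)).hasFDerivAt.comp_hasDerivAt θ (hl w θ)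
  have hm' : Continuous fun q => fderiv ℝ m q (0, 1) :=
    (hm.continuous_fderiv (by simp)).clm_apply continuous_const
  let N : Set (ℂ × ℝ) := {q | 0 < fderiv ℝ m q (0, 1)} ∩ m ⁻¹' Ioo (-T) (2 * T)
  have hN : IsOpen N := (isOpen_lt continuous_const hm').inter (isOpen_Ioo.preimage hm.continuous)
  obtain ⟨u, v, hu, -, hu0, hv, huv⟩ := generalized_tube_lemma (isCompact_singleton (x := (0 : ℂ)))
    (isCompact_Icc (a := (-1 / 4 : ℝ)) (b := 1)) hN (by
      rintro ⟨w, θ⟩ ⟨hw, hθ⟩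
      simp only [mem_singleton_iff] at hw
      subst hw
      refine ⟨?_, ?_⟩
      · have h1 := hmd 0 θ
        simp only [hm0] at h1
        have h2 := h1.unique ((hasDerivAt_id θ).const_mul T)
        simp only [Set.mem_ofPred_eq]
        rw [h2]
        simpa using hT
      · rw [mem_preimage, hm0]
        simp only [mem_Icc] at hθ
        constructor <;> nlinarith)
  obtain ⟨r₁, hr₁, hball₁⟩ := Metric.isOpen_iff.1 hu 0 (hu0 rfl)
  obtain ⟨r₂, hr₂, hball₂⟩ := Metric.eventually_nhds_iff.1 hret
  simp only [dist_zero_right] at hball₂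
  have hmN : ∀ w θ, ‖w‖ < r₁ → θ ∈ Icc (-1 / 4 : ℝ) 1 → (w, θ) ∈ N := fun w θ hw hθ =>
    huv (mk_mem_prod (hball₁ (by simpa using hw)) (hv hθ))
  let tw : ℂ × ℝ → ℂ := fun q => rotFactor (-(G (‖q.1‖ ^ 2 / 2) * q.2)) * q.1
  have hnsq : ContDiff ℝ ∞ fun q : ℂ × ℝ => ‖q.1‖ ^ 2 / 2 :=
    ((contDiff_norm_sq ℝ).comp contDiff_fst).div_const 2
  have htw : ContDiff ℝ ∞ tw :=
    (contDiff_rotFactor.comp ((hG.comp hnsq).mul contDiff_snd).neg).mul contDiff_fst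
  have htwn : ∀ q, ‖tw q‖ = ‖q.1‖ := fun q => by simp [tw]
  let Φ₀ : ℂ × ℝ → R3 := fun q => Q (tw q, m (tw q, q.2))
  have hΦ₀ : ContDiff ℝ ∞ Φ₀ := hQ.comp (htw.prodMk (hm.comp (htw.prodMk contDiff_snd)))
  let Φ : ℂ × ℝ → R3 := fun q => Φ₀ (q.1, Int.fract q.2)
  have hΦ₀per : ∀ (z : ℂ) (θ : ℝ), ‖z‖ < r₂ → |θ| < 1 / 4 → Φ₀ (z, θ + 1) = Φ₀ (z, θ) := by
    intro z θ hz hθ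
    rw [abs_lt] at hθ
    have h1 : tw (z, θ) = rotFactor (G (‖tw (z, θ + 1)‖ ^ 2 / 2)) * tw (z, θ + 1) := by
      rw [htwn]
      simp only [tw]
      rw [← mul_assoc, ← rotFactor_add]
      congr 2
      ring
    have h2 : m (tw (z, θ), θ) = T * θ := by simp [m, hS0 θ (by linarith)]
    have h3 : m (tw (z, θ + 1), θ + 1) = T * θ + τ (tw (z, θ + 1)) := by
      simp [m, hS1 (θ + 1) (by linarith)]
      ring
    simp only [Φ₀]
    rw [h3, h2, h1]
    exact (hball₂ (by rw [htwn]; exact hz) _).symm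
  have hloc : ∀ (z : ℂ) (θ : ℝ) (n : ℤ), ‖z‖ < r₂ → θ - n ∈ Ioo (-1 / 4 : ℝ) 1 →
      Φ (z, θ) = Φ₀ (z, θ - n) := by
    intro z θ n hz hθ
    simp only [Φ]
    rcases lt_or_ge (θ - n) 0 with h | h
    · have h1 : Int.fract θ = θ - n + 1 := by
        rw [Int.fract_eq_iff]
        refine ⟨by linarith [hθ.1], by linarith, n - 1, ?_⟩
        push_cast
        ring
      rw [h1, hΦ₀per z _ hz (by rw [abs_of_neg h]; linarith [hθ.1])]
    · have h1 : Int.fract θ = θ - n := by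
        rw [Int.fract_eq_iff]
        exact ⟨h, hθ.2, n, by ring⟩
      rw [h1]
  refine ⟨Φ, min r (min r₁ r₂), lt_min hr (lt_min hr₁ hr₂), fun z θ => by simp [Φ], fun θ => ?_,
    fun z θ hz => ?_⟩
  · have h1 : ∀ θ, tw (0, θ) = 0 := fun θ => by simp [tw]
    simp only [Φ, Φ₀, h1, hm0]
  obtain ⟨hz, hz₁, hz₂⟩ : ‖z‖ < r ∧ ‖z‖ < r₁ ∧ ‖z‖ < r₂ := by simpa using hz
  have hfr : θ - ⌊θ⌋ ∈ Ico (0 : ℝ) 1 := ⟨Int.fract_nonneg θ, Int.fract_lt_one θ⟩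
  have hev : Φ =ᶠ[𝓝 (z, θ)] fun q => Φ₀ (q.1, q.2 - ⌊θ⌋) := by
    have h1 : ∀ᶠ q : ℂ × ℝ in 𝓝 (z, θ), ‖q.1‖ < r₂ :=
      (isOpen_lt (by fun_prop) continuous_const).mem_nhds hz₂
    have h2 : ∀ᶠ q : ℂ × ℝ in 𝓝 (z, θ), q.2 - ⌊θ⌋ ∈ Ioo (-1 / 4 : ℝ) 1 :=
      (isOpen_Ioo.preimage (by fun_prop : Continuous fun q : ℂ × ℝ => q.2 - ⌊θ⌋)).mem_nhds
        ⟨by linarith [hfr.1], hfr.2⟩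
    filter_upwards [h1, h2] with q h1 h2
    exact hloc q.1 q.2 _ h1 h2
  have hΦ₀d : ∀ q, HasFDerivAt Φ₀ (fderiv ℝ Φ₀ q) q := fun q =>
    (hΦ₀.differentiable (by simp) q).hasFDerivAt
  have hsh : HasFDerivAt (fun q : ℂ × ℝ => (q.1, q.2 - (⌊θ⌋ : ℝ)))
      (ContinuousLinearMap.id ℝ (ℂ × ℝ)) (z, θ) := by
    refine HasFDerivAt.congr_of_eventuallyEq
      ((hasFDerivAt_id (𝕜 := ℝ) (z, θ)).sub_const ((0, (⌊θ⌋ : ℝ)) : ℂ × ℝ)) (.of_forall fun q => ?_)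
    simp [Prod.ext_iff]
  have hfd : fderiv ℝ Φ (z, θ) = fderiv ℝ Φ₀ (z, θ - ⌊θ⌋) := by
    rw [hev.fderiv_eq]
    exact (HasFDerivAt.comp (g := Φ₀) (z, θ) (hΦ₀d (z, θ - ⌊θ⌋)) hsh).fderiv
  have hval : Φ (z, θ) = Φ₀ (z, θ - ⌊θ⌋) := hev.self_of_nhds
  have hjac : spaceJac Φ (z, θ) = spaceJac Φ₀ (z, θ - ⌊θ⌋) := by
    simp only [spaceJac, hfd]
  have hcd : ContDiffAt ℝ ∞ Φ (z, θ) := by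
    refine ContDiffAt.congr_of_eventuallyEq ?_ hev
    exact (hΦ₀.comp (contDiff_fst.prodMk (contDiff_snd.sub contDiff_const))).contDiffAt
  rw [hjac, hfd, hval]
  generalize θ - ⌊θ⌋ = x at hfr
  have hwN := hmN (tw (z, x)) x (by rw [htwn]; exact hz₁) ⟨by linarith [hfr.1], hfr.2.le⟩
  obtain ⟨h1, h2, h3⟩ := htube (tw (z, x)) (m (tw (z, x), x)) (by rw [htwn]; exact hz)
    (Ioo_subset_Icc_self hwN.2)
  rw [htwn] at h2
  have hjac₀ : spaceJac Φ₀ (z, x) = fderiv ℝ m (tw (z, x), x) (0, 1) := by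
    have h4 := spaceJac_comp_twist (q := (z, x)) (hQ.differentiable (by simp) _)
      (htw.differentiable (by simp) _) (hm.differentiable (by simp) _)
    refine h4.trans ?_
    have h5 : planeDet (fderiv ℝ tw (z, x) (1, 0)) (fderiv ℝ tw (z, x) (Complex.I, 0)) = 1 := by
      have h6 : HasDerivAt (fun s => -(G (s / 2) * x)) _ (‖z‖ ^ 2) :=
        (((hG.differentiable (by simp) (‖z‖ ^ 2 / 2)).hasDerivAt.comp (‖z‖ ^ 2)
          ((hasDerivAt_id (‖z‖ ^ 2)).div_const 2)).mul_const x).neg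
      have h7 := planeJac_twist h6
      have h8 : HasFDerivAt (fun z => tw (z, x)) _ z := HasFDerivAt.comp (g := tw) z
        (htw.differentiable (by simp) (z, x)).hasFDerivAt
        ((hasFDerivAt_id z).prodMk (hasFDerivAt_const x z))
      have h9 : fderiv ℝ (fun z : ℂ => rotFactor (-(G (‖z‖ ^ 2 / 2) * x)) * z) z = _ := h8.fderiv
      rw [planeJac, h9] at h7
      simpa using h7
    rw [h3, h5, one_mul, one_mul]
  refine ⟨hcd, h1, h2, by rw [hjac₀]; exact hwN.1, ?_⟩
  rw [hjac₀]
  have hc : HasDerivAt (fun s : ℝ => ((rotFactor (G (‖z‖ ^ 2 / 2) * s) * z, x + s) : ℂ × ℝ))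
      (G (‖z‖ ^ 2 / 2) * (Complex.I * z), 1) 0 := by
    refine HasDerivAt.prodMk ?_ ((hasDerivAt_id (0 : ℝ)).const_add x)
    have h4 := HasDerivAt.scomp (0 : ℝ) (hasDerivAt_rotFactor (G (‖z‖ ^ 2 / 2) * 0))
      ((hasDerivAt_id (0 : ℝ)).const_mul (G (‖z‖ ^ 2 / 2)))
    convert! h4.mul_const z using 1
    simp
    ring
  have h5 := HasFDerivAt.comp_hasDerivAt (l := Φ₀) (0 : ℝ) (by simpa using hΦ₀d (z, x)) hc
  have h6 : ∀ s : ℝ, Φ₀ (rotFactor (G (‖z‖ ^ 2 / 2) * s) * z, x + s) =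
      Q (tw (z, x), m (tw (z, x), x + s)) := by
    intro s
    have h7 : tw (rotFactor (G (‖z‖ ^ 2 / 2) * s) * z, x + s) = tw (z, x) := by
      simp only [tw, norm_mul, norm_rotFactor, one_mul]
      rw [← mul_assoc, ← rotFactor_add]
      congr 2
      ring
    simp only [Φ₀, h7]
  have h8 : HasDerivAt (fun s => Q (tw (z, x), m (tw (z, x), x + s)))
      (fderiv ℝ m (tw (z, x), x) (0, 1) • B (Q (tw (z, x), m (tw (z, x), x)))) 0 := by
    have h9 : HasDerivAt (fun s => m (tw (z, x), x + s)) (fderiv ℝ m (tw (z, x), x) (0, 1)) 0 := by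
      have := hmd (tw (z, x)) (x + 0)
      simpa using this.comp_const_add x 0
    exact HasDerivAt.scomp (0 : ℝ) (by simpa using hQd (tw (z, x)) (m (tw (z, x), x))) h9
  refine h5.unique ?_
  simp only [Function.comp_def, h6]
  exact h8

end Suspension

noncomputable section Assembly
open Set Filter Topology RealInnerProductSpace
open scoped ContDiff Real

theorem exists_injOn_mod_period {Φ : ℂ × ℝ → R3} {r : ℝ} (hr : 0 < r)
    (hper : ∀ z θ, Φ (z, θ + 1) = Φ (z, θ))
    (hcd : ∀ (z : ℂ) (θ : ℝ), ‖z‖ < r → ContDiffAt ℝ ∞ Φ (z, θ))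
    (hjac : ∀ (z : ℂ) (θ : ℝ), ‖z‖ < r → spaceJac Φ (z, θ) ≠ 0)
    (hinj : ∀ θ θ', Φ (0, θ) = Φ (0, θ') → ∃ n : ℤ, θ - θ' = n) :
    ∃ r', 0 < r' ∧ ∀ (z z' : ℂ) (θ θ' : ℝ), ‖z‖ < r' → ‖z'‖ < r' → Φ (z, θ) = Φ (z', θ') →
      z = z' ∧ ∃ n : ℤ, θ - θ' = n := by
  have hper' : ∀ (z : ℂ) (θ : ℝ) (n : ℤ), Φ (z, θ + n) = Φ (z, θ) := by
    intro z θ n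
    have h : Function.Periodic (fun θ => Φ (z, θ)) 1 := hper z
    simpa using h.int_mul n θ
  have h0 : ‖(0 : ℂ)‖ < r := by simpa using hr
  have key : ∀ᶠ x : ℂ × ℂ in 𝓝 (0, 0), ∀ y ∈ Icc (0 : ℝ) 1 ×ˢ Icc (0 : ℝ) 1,
      Φ (x.1, y.1) = Φ (x.2, y.2) → x.1 = x.2 ∧ ∃ n : ℤ, y.1 - y.2 = n := by
    refine (isCompact_Icc.prod isCompact_Icc).eventually_forall_of_forall_eventually ?_
    rintro ⟨θ, θ'⟩ -
    have hq : Tendsto (fun q : (ℂ × ℂ) × ℝ × ℝ => (q.1.1, q.2.1)) (𝓝 ((0, 0), θ, θ'))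
        (𝓝 (0, θ)) := by
      have : Continuous fun q : (ℂ × ℂ) × ℝ × ℝ => (q.1.1, q.2.1) := by fun_prop
      exact this.tendsto ((0, 0), θ, θ')
    by_cases h : Φ (0, θ) = Φ (0, θ')
    · obtain ⟨n, hn⟩ := hinj θ θ' h
      have hq' : Tendsto (fun q : (ℂ × ℂ) × ℝ × ℝ => (q.1.2, q.2.2 + n)) (𝓝 ((0, 0), θ, θ'))
          (𝓝 (0, θ)) := by
        have : Continuous fun q : (ℂ × ℂ) × ℝ × ℝ => (q.1.2, q.2.2 + (n : ℝ)) := by fun_prop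
        have h1 := this.tendsto ((0, 0), θ, θ')
        simpa [← hn] using h1
      obtain ⟨e, he⟩ := isInvertible_of_triple_ne_zero (hjac 0 θ h0)
      have h1 : HasStrictFDerivAt Φ (e : ℂ × ℝ →L[ℝ] R3) (0, θ) := by
        rw [he]
        exact (hcd 0 θ h0).hasStrictFDerivAt (by simp)
      have h2 := h1.eventually_left_inverse
      filter_upwards [hq.eventually h2, hq'.eventually h2] with q h3 h4 h5
      rw [h5, ← hper' _ _ n, h4] at h3
      simp only [Prod.mk.injEq] at h3
      exact ⟨h3.1.symm, n, by linarith [h3.2]⟩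
    · have hq' : Tendsto (fun q : (ℂ × ℂ) × ℝ × ℝ => (q.1.2, q.2.2)) (𝓝 ((0, 0), θ, θ'))
          (𝓝 (0, θ')) := by
        have : Continuous fun q : (ℂ × ℂ) × ℝ × ℝ => (q.1.2, q.2.2) := by fun_prop
        exact this.tendsto ((0, 0), θ, θ')
      have h1 := ((hcd 0 θ h0).continuousAt.tendsto.comp hq).prodMk_nhds
        ((hcd 0 θ' h0).continuousAt.tendsto.comp hq')
      filter_upwards [h1.eventually (isClosed_diagonal.isOpen_compl.mem_nhds h)] with q h2 h3
      exact absurd h3 h2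
  obtain ⟨r', hr', hball⟩ := Metric.eventually_nhds_iff.1 key
  refine ⟨r', hr', fun z z' θ θ' hz hz' h => ?_⟩
  have hf : ∀ (z : ℂ) (θ : ℝ), Φ (z, θ) = Φ (z, Int.fract θ) := fun z θ => by
    rw [← hper' z (Int.fract θ) ⌊θ⌋, Int.fract_add_floor]
  rw [hf, hf z'] at h
  have hm : ∀ θ : ℝ, Int.fract θ ∈ Icc (0 : ℝ) 1 := fun θ =>
    ⟨Int.fract_nonneg θ, (Int.fract_lt_one θ).le⟩
  obtain ⟨h1, n, hn⟩ := hball (y := (z, z')) (by simp [Prod.dist_eq, hz, hz'])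
    (Int.fract θ, Int.fract θ') (mk_mem_prod (hm _) (hm _)) h
  refine ⟨h1, n + ⌊θ⌋ - ⌊θ'⌋, ?_⟩
  push_cast
  simp only [Int.fract] at hn
  linarith

theorem exists_solid_torus_chart {U : Set R3} {B : R3 → R3} {p : R3 → ℝ} {c : ℝ → R3} {T : ℝ}
    (hU : IsOpen U) (hB : ContDiffOn ℝ ∞ B U) (hp : ContDiffOn ℝ ∞ p U)
    (hdiv : ∀ z ∈ U, divg B z = 0) (hBp : ∀ z ∈ U, fderiv ℝ p z (B z) = 0)
    (hc : ∀ t, HasDerivAt c (B (c t)) t) (hcU : ∀ t, c t ∈ U) (hcc : IsCompact (range c))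
    (hT : 0 < T) (hper : ∀ t, c (t + T) = c t) (hB0 : B (c 0) ≠ 0) (hp0 : fderiv ℝ p (c 0) = 0)
    (hpos : ∀ u, u ≠ 0 → ⟪u, B (c 0)⟫ = 0 → 0 < fderiv ℝ (fderiv ℝ p) (c 0) u u) :
    ∃ (Φ : ℂ × ℝ → R3) (P G : ℝ → ℝ) (r : ℝ), 0 < r ∧ ContDiff ℝ ∞ P ∧ ContDiff ℝ ∞ G ∧
      (∀ z θ, Φ (z, θ + 1) = Φ (z, θ)) ∧ range (fun θ => Φ (0, θ)) = range c ∧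
      (∀ (z z' : ℂ) (θ θ' : ℝ), ‖z‖ < r → ‖z'‖ < r → Φ (z, θ) = Φ (z', θ') →
        z = z' ∧ ∃ n : ℤ, θ - θ' = n) ∧
      ∀ (z : ℂ) (θ : ℝ), ‖z‖ < r → ContDiffAt ℝ ∞ Φ (z, θ) ∧ Φ (z, θ) ∈ U ∧
        p (Φ (z, θ)) = P (‖z‖ ^ 2 / 2) ∧ 0 < spaceJac Φ (z, θ) ∧
        fderiv ℝ Φ (z, θ) (G (‖z‖ ^ 2 / 2) * (Complex.I * z), 1) =
          spaceJac Φ (z, θ) • B (Φ (z, θ)) := by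
  have hcU' : range c ⊆ U := range_subset_iff.2 hcU
  obtain ⟨B', hB', hB'c, hBB'⟩ := exists_contDiff_eventuallyEq_nhdsSet hcc hU hcU' hB
  obtain ⟨p', hp', -, hpp'⟩ := exists_contDiff_eventuallyEq_nhdsSet hcc hU hcU' hp
  obtain ⟨W, hW, hcW, hWsub⟩ := mem_nhdsSet_iff_exists.1
    ((hBB'.and hpp').and (hU.mem_nhdsSet.2 hcU'))
  have hWU : ∀ z ∈ W, z ∈ U := fun z hz => (hWsub hz).2
  have hcW' : ∀ t, c t ∈ W := fun t => hcW (mem_range_self t)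
  have hBe : ∀ z ∈ W, B' =ᶠ[𝓝 z] B := fun z hz => by
    filter_upwards [hW.mem_nhds hz] with y hy using (hWsub hy).1.1
  have hpe : ∀ z ∈ W, p' =ᶠ[𝓝 z] p := fun z hz => by
    filter_upwards [hW.mem_nhds hz] with y hy using (hWsub hy).1.2
  have hBv : ∀ z ∈ W, B' z = B z := fun z hz => (hBe z hz).self_of_nhds
  have hdiv' : ∀ z ∈ W, divg B' z = 0 := fun z hz => by
    rw [divg, (hBe z hz).fderiv_eq]
    exact hdiv z (hWU z hz)
  have hBp' : ∀ z ∈ W, fderiv ℝ p' z (B' z) = 0 := fun z hz => by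
    rw [(hpe z hz).fderiv_eq, hBv z hz]
    exact hBp z (hWU z hz)
  have hc' : ∀ t, HasDerivAt c (B' (c t)) t := fun t => by
    rw [hBv _ (hcW' t)]
    exact hc t
  have hB0' : B' (c 0) ≠ 0 := by rwa [hBv _ (hcW' 0)]
  have hp0' : fderiv ℝ p' (c 0) = 0 := by rwa [(hpe _ (hcW' 0)).fderiv_eq]
  have hpos' : ∀ u, u ≠ 0 → ⟪u, B' (c 0)⟫ = 0 → 0 < fderiv ℝ (fderiv ℝ p') (c 0) u u := by
    rw [(hpe _ (hcW' 0)).fderiv.fderiv_eq, hBv _ (hcW' 0)]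
    exact hpos
  have huniq : ∀ s t, c s = c t → ∀ u, c (s + u) = c (t + u) := by
    obtain ⟨Q, P, r, -, -, -, hQc, -, hsh, -⟩ := exists_flux_tube hB' hB'c hp' hW hdiv' hBp' hc'
      hcW' hT hB0' hp0' hpos'
    intro s t hst u
    rw [← hQc, ← hQc]
    exact hsh 0 0 s t (by rw [hQc, hQc, hst]) u
  have hne : ∃ t, c t ≠ c 0 := by
    by_contra! h
    have h1 : HasDerivAt c 0 0 := by
      rw [show c = fun _ => c 0 from funext h]
      exact hasDerivAt_const _ _
    exact hB0 ((hc 0).unique h1)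
  have hcont : Continuous c := continuous_iff_continuousAt.2 fun t => (hc t).continuousAt
  obtain ⟨S, hS, hperS, hmin⟩ := exists_minimal_period hcont huniq hT hper hne
  obtain ⟨Q, P, r, hQ, hP, hr, hQc, hQd, hsh, htube, hPinj⟩ := exists_flux_tube hB' hB'c hp' hW
    hdiv' hBp' hc' hcW' hS hB0' hp0' hpos'
  have hQper : Q (0, S) = Q (0, 0) := by
    rw [hQc, hQc]
    simpa using hperS 0
  obtain ⟨G, τ, hG, hτ, hτ0, hret⟩ := exists_return_map hQ hr hS hsh
    (fun w t hw ht => (htube w t hw ht).2) hPinj hQper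
  obtain ⟨Φ, r₁, hr₁, hΦper, hΦ0, hΦ⟩ := exists_suspension hQ hG hτ hr hS hτ0 hQd htube hret
  have hΦc : ∀ θ, Φ (0, θ) = c (S * θ) := by
    intro θ
    rw [hΦ0, hQc]
    have h : Function.Periodic c S := hperS
    have h1 := (h.int_mul ⌊θ⌋) (S * Int.fract θ)
    rw [← h1]
    congr 1
    simp only [Int.fract]
    ring
  obtain ⟨r₂, hr₂, hinj⟩ := exists_injOn_mod_period hr₁ hΦper (fun z θ hz => (hΦ z θ hz).1)
    (fun z θ hz => (hΦ z θ hz).2.2.2.1.ne') (by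
      intro θ θ' h
      rw [hΦc, hΦc] at h
      obtain ⟨n, hn⟩ := hmin _ _ h
      exact ⟨n, mul_left_cancel₀ hS.ne' (by linarith)⟩)
  refine ⟨Φ, P, G, min r₁ r₂, lt_min hr₁ hr₂, hP, hG, hΦper, ?_, fun z z' θ θ' hz hz' h =>
    hinj z z' θ θ' (hz.trans_le (min_le_right _ _)) (hz'.trans_le (min_le_right _ _)) h,
    fun z θ hz => ?_⟩
  · simp only [hΦc]
    exact (mul_left_surjective₀ hS.ne').range_comp c
  · obtain ⟨h1, h2, h3, h4, h5⟩ := hΦ z θ (hz.trans_le (min_le_left _ _))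
    rw [← (hpe _ h2).self_of_nhds, ← hBv _ h2]
    exact ⟨h1, hWU _ h2, h3, h4, h5⟩

theorem hess_eq_fderiv_fderiv (p : R3 → ℝ) (z u v : R3) :
    hess p z u v = fderiv ℝ (fderiv ℝ p) z u v := by
  simp [hess, iteratedFDeriv_two_apply]

theorem exists_axis_chart {U : Set R3} {B J : R3 → R3} {p : R3 → ℝ} {γ : Set R3}
    (hBJp : IntegrableMagneticField U B J p) (hγ : IsNondegenerateEllipticAxis U B p γ) :
    ∃ (Φ : ℂ × ℝ → R3) (P G : ℝ → ℝ) (r : ℝ), 0 < r ∧ ContDiff ℝ ∞ P ∧ ContDiff ℝ ∞ G ∧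
      (∀ z θ, Φ (z, θ + 1) = Φ (z, θ)) ∧ range (fun θ => Φ (0, θ)) = γ ∧
      (∀ (z z' : ℂ) (θ θ' : ℝ), ‖z‖ < r → ‖z'‖ < r → Φ (z, θ) = Φ (z', θ') →
        z = z' ∧ ∃ n : ℤ, θ - θ' = n) ∧
      ∀ (z : ℂ) (θ : ℝ), ‖z‖ < r → ContDiffAt ℝ ∞ Φ (z, θ) ∧ Φ (z, θ) ∈ U ∧
        p (Φ (z, θ)) = P (‖z‖ ^ 2 / 2) ∧ 0 < spaceJac Φ (z, θ) ∧
        fderiv ℝ Φ (z, θ) (G (‖z‖ ^ 2 / 2) * (Complex.I * z), 1) =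
          spaceJac Φ (z, θ) • B (Φ (z, θ)) := by
  obtain ⟨hU, hB, -, hp, hB0, hdiv, -, hham⟩ := hBJp
  obtain ⟨hγc, hγU, ⟨c, T, hT, hcU, hper, hc, rfl⟩, hgrad, hhess⟩ := hγ
  have hfd : ∀ z ∈ U, ∀ v, fderiv ℝ p z v = ⟪gradient p z, v⟫ := fun z hz v => by
    rw [gradient, InnerProductSpace.toDual_symm_apply]
  have hBp : ∀ z ∈ U, fderiv ℝ p z (B z) = 0 := fun z hz => by
    rw [hfd z hz, ← hham z hz, inner_cross3_right]
  have hp0 : fderiv ℝ p (c 0) = 0 := by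
    ext v
    rw [hfd _ (hcU 0), hgrad _ (mem_range_self 0)]
    simp
  simp only [hess_eq_fderiv_fderiv] at hhess
  rcases hhess (c 0) (mem_range_self 0) with h | h
  · exact exists_solid_torus_chart hU hB hp hdiv hBp hc hcU hγc hT hper (hB0 _ (hcU 0)) hp0 h
  · have hneg : fderiv ℝ (fun z => -p z) = fun z => -fderiv ℝ p z := funext fun z => fderiv_fun_neg
    obtain ⟨Φ, P, G, r, hr, hP, hG, h1, h2, h3, h4⟩ := exists_solid_torus_chart hU hB
      (p := fun z => -p z) hp.neg hdiv (fun z hz => by simp [hBp z hz]) hc hcU hγc hT hper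
      (hB0 _ (hcU 0)) (by simp [hp0]) (fun u hu hu' => by
        rw [hneg, fderiv_fun_neg]
        simpa using h u hu hu')
    refine ⟨Φ, fun s => -P s, G, r, hr, hP.neg, hG, h1, h2, h3, fun z θ hz => ?_⟩
    obtain ⟨h5, h6, h7, h8, h9⟩ := h4 z θ hz
    exact ⟨h5, h6, by linarith, h8, h9⟩

theorem det_eq_triple (L : R3 →ₗ[ℝ] R3) :
    LinearMap.det L = triple (L (e3 0)) (L (e3 1)) (L (e3 2)) := by
  rw [← det_mul_triple]
  simp [triple, e3]

/-- Cylindrical coordinates `(x, y, φ)` as a complex number and an angle normalized to period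
one. -/
def cylinderCoord : R3 →L[ℝ] ℂ × ℝ :=
  ((Complex.equivRealProdCLM.symm : ℝ × ℝ →L[ℝ] ℂ) ∘L
    ((EuclideanSpace.proj 0 : R3 →L[ℝ] ℝ).prod (EuclideanSpace.proj 1 : R3 →L[ℝ] ℝ))).prod
      ((2 * π)⁻¹ • (EuclideanSpace.proj 2 : R3 →L[ℝ] ℝ))

theorem cylinderCoord_apply (q : R3) : cylinderCoord q = (⟨q 0, q 1⟩, (2 * π)⁻¹ * q 2) := rfl

theorem norm_cylinderCoord_sq (q : R3) : ‖(cylinderCoord q).1‖ ^ 2 = q 0 ^ 2 + q 1 ^ 2 := by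
  rw [Complex.sq_norm, Complex.normSq_apply, cylinderCoord_apply]
  ring

theorem mem_Dset_iff {r : ℝ} (hr : 0 < r) {q : R3} : q ∈ Dset r ↔ ‖(cylinderCoord q).1‖ < r := by
  rw [Dset, Set.mem_ofPred_eq, ← norm_cylinderCoord_sq, sq_lt_sq₀ (norm_nonneg _) hr.le]

theorem cylinderCoord_pt (x y φ : ℝ) : cylinderCoord (pt x y φ) = (⟨x, y⟩, (2 * π)⁻¹ * φ) := by
  simp [cylinderCoord_apply, pt]

theorem det_fderiv_comp_cylinderCoord {Φ : ℂ × ℝ → R3} {q : R3}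
    (h : DifferentiableAt ℝ Φ (cylinderCoord q)) :
    LinearMap.det (fderiv ℝ (Φ ∘ cylinderCoord) q).toLinearMap =
      (2 * π)⁻¹ * spaceJac Φ (cylinderCoord q) := by
  have h0 : cylinderCoord (e3 0) = (1, 0) := by
    simp [cylinderCoord_apply, e3, Complex.ext_iff]
  have h1 : cylinderCoord (e3 1) = (Complex.I, 0) := by
    simp [cylinderCoord_apply, e3, Complex.ext_iff]
  have h2 : cylinderCoord (e3 2) = (2 * π)⁻¹ • (0, 1) := by
    simp [cylinderCoord_apply, e3, Complex.ext_iff]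
  rw [det_eq_triple, fderiv_comp q h cylinderCoord.differentiableAt, cylinderCoord.fderiv]
  simp only [ContinuousLinearMap.coe_coe, ContinuousLinearMap.comp_apply, h0, h1, h2, map_smul,
    spaceJac]
  simp only [triple, PiLp.smul_apply, smul_eq_mul]
  ring

theorem exists_antideriv {G : ℝ → ℝ} (hG : ContDiff ℝ ∞ G) :
    ∃ Ψ : ℝ → ℝ, ContDiff ℝ ∞ Ψ ∧ deriv Ψ = G := by
  have h : ∀ s, HasDerivAt (fun s => ∫ t in (0 : ℝ)..s, G t) (G s) s := fun s =>
    intervalIntegral.integral_hasDerivAt_right (hG.continuous.intervalIntegrable _ _)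
      hG.continuous.aestronglyMeasurable.stronglyMeasurableAtFilter hG.continuous.continuousAt
  have h' : deriv (fun s => ∫ t in (0 : ℝ)..s, G t) = G := funext fun s => (h s).deriv
  refine ⟨_, contDiff_infty_iff_deriv.2 ⟨fun s => (h s).differentiableAt, ?_⟩, h'⟩
  rwa [h']

end Assembly

/-- **Normal form near an elliptic magnetic axis** (Theorem 1, elliptic case). -/
theorem elliptic_normal_form
    (U : Set R3) (B J : R3 → R3) (p : R3 → ℝ) (γ : Set R3)
    (hBJp : IntegrableMagneticField U B J p)
    (hγ : IsNondegenerateEllipticAxis U B p γ) :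
    ∃ (r δ : ℝ) (Φ : R3 → R3) (P Ψ : ℝ → ℝ) (c : ℝ),
      0 < r ∧ 0 < δ ∧ (c = 1 ∨ c = -1) ∧
      -- Φ is C^∞ on D_r × ℝ, with values in U
      ContDiffOn ℝ (⊤ : ℕ∞) Φ (Dset r) ∧ (∀ q ∈ Dset r, Φ q ∈ U) ∧
      -- P and Ψ are C^∞ on (−δ, r²/2)
      ContDiffOn ℝ (⊤ : ℕ∞) P (Set.Ioo (-δ) (r ^ 2 / 2)) ∧
      ContDiffOn ℝ (⊤ : ℕ∞) Ψ (Set.Ioo (-δ) (r ^ 2 / 2)) ∧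
      -- (i) periodicity in φ
      (∀ x y φ : ℝ, Φ (pt x y (φ + 2 * Real.pi)) = Φ (pt x y φ)) ∧
      -- (ii) everywhere invertible differential …
      (∀ q ∈ Dset r, LinearMap.det (fderiv ℝ Φ q).toLinearMap ≠ 0) ∧
      -- … open image containing γ …
      IsOpen (Φ '' Dset r) ∧ γ ⊆ Φ '' Dset r ∧
      -- … the core maps onto γ …
      Set.range (fun φ : ℝ => Φ (pt 0 0 φ)) = γ ∧
      -- … and Φ is injective modulo 2π in the angle
      (∀ q ∈ Dset r, ∀ q' ∈ Dset r,
        (Φ q = Φ q' ↔ (q 0 = q' 0 ∧ q 1 = q' 1 ∧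
          ∃ n : ℤ, q 2 - q' 2 = 2 * Real.pi * (n : ℝ)))) ∧
      -- (iii) the normal form: p ∘ Φ = P(ψ) and the pulled-back flux field of B is
      -- (−Ψ′(ψ)·y, Ψ′(ψ)·x, c), expressed as DΦ(w) = det(DΦ) • (B ∘ Φ),
      -- which for invertible DΦ is equivalent to det(DΦ) · (DΦ)⁻¹(B∘Φ) = w
      (∀ q ∈ Dset r,
        p (Φ q) = P (((q 0) ^ 2 + (q 1) ^ 2) / 2) ∧
        fderiv ℝ Φ q
            (pt (-(deriv Ψ (((q 0) ^ 2 + (q 1) ^ 2) / 2)) * q 1)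
                ((deriv Ψ (((q 0) ^ 2 + (q 1) ^ 2) / 2)) * q 0) c)
          = LinearMap.det (fderiv ℝ Φ q).toLinearMap • B (Φ q)) := by
  obtain ⟨Φ, P, G, r, hr, hP, hG, hper, hrange, hinj, hΦ⟩ := exists_axis_chart hBJp hγ
  obtain ⟨Ψ, hΨ, hΨ'⟩ := exists_antideriv (hG.const_smul (2 * Real.pi)⁻¹)
  have hπ : (2 * Real.pi)⁻¹ * (2 * Real.pi) = 1 := inv_mul_cancel₀ (by positivity)
  have hmem : ∀ q ∈ Dset r, ‖(cylinderCoord q).1‖ < r := fun q hq => (mem_Dset_iff hr).1 hq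
  have hd : ∀ q ∈ Dset r, DifferentiableAt ℝ Φ (cylinderCoord q) := fun q hq =>
    (hΦ _ (cylinderCoord q).2 (hmem q hq)).1.differentiableAt (by simp)
  have hper' : ∀ (z : ℂ) (θ : ℝ) (n : ℤ), Φ (z, θ + n) = Φ (z, θ) := by
    intro z θ n
    have h : Function.Periodic (fun θ => Φ (z, θ)) 1 := hper z
    simpa using h.int_mul n θ
  have hrange' : Set.range (fun φ : ℝ => (Φ ∘ cylinderCoord) (pt 0 0 φ)) = γ := by
    rw [← hrange]
    simp only [Function.comp_apply, cylinderCoord_pt]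
    exact (mul_left_surjective₀ (show (2 * Real.pi)⁻¹ ≠ 0 by positivity)).range_comp
      (fun θ => Φ (0, θ))
  refine ⟨r, 1, Φ ∘ cylinderCoord, P, Ψ, 1, hr, one_pos, Or.inl rfl, fun q hq => ?_, fun q hq => ?_,
    hP.contDiffOn, hΨ.contDiffOn, fun x y φ => ?_, fun q hq => ?_, ?_, ?_, hrange',
    fun q hq q' hq' => ?_, fun q hq => ⟨?_, ?_⟩⟩
  · exact ((hΦ _ (cylinderCoord q).2 (hmem q hq)).1.comp q
      cylinderCoord.contDiff.contDiffAt).contDiffWithinAt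
  · exact (hΦ _ (cylinderCoord q).2 (hmem q hq)).2.1
  · simp only [Function.comp_apply, cylinderCoord_pt]
    rw [mul_add, hπ, hper]
  · rw [det_fderiv_comp_cylinderCoord (hd q hq)]
    exact mul_ne_zero (by positivity) (hΦ _ (cylinderCoord q).2 (hmem q hq)).2.2.2.1.ne'
  · rw [isOpen_iff_mem_nhds]
    rintro _ ⟨q, hq, rfl⟩
    obtain ⟨h1, -, -, h2, -⟩ := hΦ _ (cylinderCoord q).2 (hmem q hq)
    have hD : Dset r ∈ nhds q := by
      have : Dset r = {q : R3 | ‖(cylinderCoord q).1‖ < r} := Set.ext fun q => mem_Dset_iff hr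
      rw [this]
      exact (isOpen_lt (by fun_prop) continuous_const).mem_nhds (hmem q hq)
    have h3 := (h1.comp q cylinderCoord.contDiff.contDiffAt).hasStrictFDerivAt (by simp)
    have h4 : LinearMap.det (fderiv ℝ (Φ ∘ cylinderCoord) q).toLinearMap ≠ 0 := by
      rw [det_fderiv_comp_cylinderCoord (hd q hq)]
      exact mul_ne_zero (by positivity) h2.ne'
    have h5 : (fderiv ℝ (Φ ∘ cylinderCoord) q).range = ⊤ :=
      (LinearMap.isUnit_iff_range_eq_top _).1 ((LinearMap.isUnit_iff_isUnit_det _).2 h4.isUnit)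
    rw [← h3.map_nhds_eq_of_surj h5]
    exact Filter.image_mem_map hD
  · rw [← hrange']
    rintro _ ⟨φ, rfl⟩
    refine ⟨pt 0 0 φ, ?_, rfl⟩
    simp [Dset, pt, hr]
  · have hq2 : ∀ q : R3, cylinderCoord q = (⟨q 0, q 1⟩, (2 * Real.pi)⁻¹ * q 2) :=
      cylinderCoord_apply
    constructor
    · intro h
      obtain ⟨h1, n, hn⟩ := hinj _ _ (cylinderCoord q).2 (cylinderCoord q').2 (hmem q hq)
        (hmem q' hq') h
      simp only [hq2, Complex.ext_iff] at h1 hn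
      exact ⟨h1.1, h1.2, n, by rw [← hn]; linear_combination -(q 2 - q' 2) * hπ⟩
    · rintro ⟨h1, h2, n, hn⟩
      simp only [Function.comp_apply, hq2, h1, h2]
      rw [← hper' _ ((2 * Real.pi)⁻¹ * q' 2) n]
      congr 2
      linear_combination (2 * Real.pi)⁻¹ * hn + n * hπ
  · rw [← norm_cylinderCoord_sq]
    exact (hΦ _ (cylinderCoord q).2 (hmem q hq)).2.2.1
  · obtain ⟨-, -, -, -, h⟩ := hΦ _ (cylinderCoord q).2 (hmem q hq)
    rw [norm_cylinderCoord_sq] at h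
    rw [det_fderiv_comp_cylinderCoord (hd q hq), mul_smul, Function.comp_apply, ← h, ← map_smul,
      fderiv_comp q (hd q hq) cylinderCoord.differentiableAt, cylinderCoord.fderiv, hΨ',
      ContinuousLinearMap.comp_apply, cylinderCoord_pt, cylinderCoord_apply q]
    congr 1
    refine Prod.ext (Complex.ext ?_ ?_) ?_ <;> simp <;> ring
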